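/- Assume GRH. Let Φ: ℝ → ℝ be a fixed smooth compactly supported function with support contained in (0,∞), and fix ε > 0. Then there exist constants C > 0 and x₀ such that for all x ≥ x₀, all y ≥ 2, and all real α ∈ [0,1] written as α = a/q + γ with integers a, q satisfying gcd(a,q) = 1, 1 ≤ q ≤ √x, and |γ| ≤ 1/(q√x), one has |E(x,y;α) − M(x,y;q,γ)| ≤ C·x^{3/4+ε}, where M(x,y;q,γ) = Σ_{n ≥ 1, n y-smooth} (μ(q/gcd(q,n))/φ(q/gcd(q,n)))·e(nγ)·Φ(n/x). -/

import Mathlib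

noncomputable section

/-- The Generalized Riemann Hypothesis. -/
def GRH : Prop :=
  (∀ s : ℂ, 0 < s.re → s.re < 1 → riemannZeta s = 0 → s.re = 1 / 2) ∧
  (∀ (N : ℕ) [NeZero N] (χ : DirichletCharacter ℂ N) (s : ℂ),
    0 < s.re → s.re < 1 → DirichletCharacter.LFunction χ s = 0 → s.re = 1 / 2)

/-- The weighted exponential sum `E(x,y;α)` over `y`-smooth positive integers. -/
def Esum (x y : ℝ) (Φ : ℝ → ℝ) (α : ℝ) : ℂ :=
  ∑' n : {n : ℕ // 0 < n ∧ ∀ p : ℕ, p.Prime → p ∣ n → (p : ℝ) ≤ y},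
    Complex.exp (2 * (Real.pi : ℂ) * Complex.I * ((n : ℕ) : ℂ) * (α : ℂ)) *
      ((Φ (((n : ℕ) : ℝ) / x) : ℝ) : ℂ)

/-- The local main term `M(x,y;q,γ)`. -/
def Mterm (x y : ℝ) (Φ : ℝ → ℝ) (q : ℕ) (γ : ℝ) : ℂ :=
  ∑' n : {n : ℕ // 0 < n ∧ ∀ p : ℕ, p.Prime → p ∣ n → (p : ℝ) ≤ y},
    (((ArithmeticFunction.moebius (q / Nat.gcd q (n : ℕ)) : ℝ) /
        (Nat.totient (q / Nat.gcd q (n : ℕ)) : ℝ) : ℝ) : ℂ) *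
      Complex.exp (2 * (Real.pi : ℂ) * Complex.I * ((n : ℕ) : ℂ) * (γ : ℂ)) *
      ((Φ (((n : ℕ) : ℝ) / x) : ℝ) : ℂ)

namespace SmoothExpSum

open Complex Set Filter Topology MeasureTheory FourierTransform

/-- Partial sums of a non-trivial Dirichlet character are bounded by its modulus. -/
lemma norm_sum_range_char_le {N : ℕ} [NeZero N] {χ : DirichletCharacter ℂ N} (hχ : χ ≠ 1)
    (a n : ℕ) : ‖∑ k ∈ Finset.range n, χ ((a + k : ℕ) : ZMod N)‖ ≤ N := by
  induction n using Nat.strong_induction_on generalizing a with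
  | _ n ih =>
    rcases lt_or_ge n N with h | h
    · calc ‖∑ k ∈ Finset.range n, χ ((a + k : ℕ) : ZMod N)‖
          ≤ ∑ k ∈ Finset.range n, 1 :=
            norm_sum_le_of_le _ fun k _ => DirichletCharacter.norm_le_one χ _
        _ ≤ N := by simpa using h.le
    · obtain ⟨m, rfl⟩ := Nat.exists_eq_add_of_le h
      have hfull : ∑ k ∈ Finset.range N, χ ((a + k : ℕ) : ZMod N) = 0 := by
        have h1 : ∑ z : ZMod N, χ ((a : ZMod N) + z) = 0 := by
          exact (Equiv.sum_comp (Equiv.addLeft (a : ZMod N)) (fun z => χ z)).trans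
            (MulChar.sum_eq_zero_of_ne_one hχ)
        rw [← h1]
        symm
        refine Finset.sum_bij' (fun z _ => z.val) (fun k _ => (k : ZMod N)) ?_ ?_ ?_ ?_ ?_
        · intro z _; simpa using ZMod.val_lt z
        · simp
        · intro z _; simp
        · intro k hk; exact ZMod.val_cast_of_lt (by simpa using hk)
        · intro z _; simp
      rw [Finset.sum_range_add, hfull, zero_add]
      have := ih m (by have := NeZero.pos N; omega) (a + N)
      simpa [add_assoc] using this

lemma norm_sum_Icc_char_le {N : ℕ} [NeZero N] {χ : DirichletCharacter ℂ N} (hχ : χ ≠ 1)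
    (n : ℕ) : ‖∑ k ∈ Finset.Icc 1 n, χ (k : ZMod N)‖ ≤ N := by
  have := norm_sum_range_char_le hχ 1 n
  rw [← Finset.Ico_add_one_right_eq_Icc, Finset.sum_Ico_eq_sum_range]
  simpa using this

/-- The summatory function of a Dirichlet character. -/
def charSum {N : ℕ} (χ : DirichletCharacter ℂ N) (t : ℝ) : ℂ :=
  ∑ k ∈ Finset.Icc 1 ⌊t⌋₊, χ (k : ZMod N)

lemma measurable_charSum {N : ℕ} (χ : DirichletCharacter ℂ N) : Measurable (charSum χ) := by
  unfold charSum
  exact (measurable_from_nat (f := fun m : ℕ => ∑ k ∈ Finset.Icc 1 m, χ (k : ZMod N))).comp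
    Nat.measurable_floor

lemma charSum_of_lt_one {N : ℕ} (χ : DirichletCharacter ℂ N) {t : ℝ} (ht : t < 1) :
    charSum χ t = 0 := by
  simp [charSum, Nat.floor_eq_zero.2 ht]

lemma mellin_charSum {N : ℕ} (χ : DirichletCharacter ℂ N) (s : ℂ) :
    mellin (charSum χ) (-s) = ∫ t in Ioi (1 : ℝ), charSum χ t * (t : ℂ) ^ (-(s + 1)) := by
  rw [← integral_Ici_eq_integral_Ioi, mellin]
  refine setIntegral_eq_of_subset_of_forall_sdiff_eq_zero measurableSet_Ioi
    (fun t ht => lt_of_lt_of_le one_pos ht) ?_ |>.trans ?_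
  · intro t ht
    rw [charSum_of_lt_one χ (not_le.1 ht.2), smul_zero]
  · congr 1; ext t; rw [smul_eq_mul, mul_comm]; ring_nf

lemma LFunction_eq_mul_integral {N : ℕ} [NeZero N] {χ : DirichletCharacter ℂ N} (hχ : χ ≠ 1)
    {s : ℂ} (hs : 0 < s.re) :
    χ.LFunction s = s * ∫ t in Ioi (1 : ℝ), charSum χ t * (t : ℂ) ^ (-(s + 1)) := by
  have hbd : ∀ t, ‖charSum χ t‖ ≤ N := fun t => norm_sum_Icc_char_le hχ _
  set U : Set ℂ := {z | 0 < z.re} with hU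
  have hUo : IsOpen U := isOpen_lt continuous_const continuous_re
  have hd : DifferentiableOn ℂ (fun s => s * mellin (charSum χ) (-s)) U := by
    intro z hz
    have hz' : 0 < z.re := hz
    refine (differentiableAt_id.mul ?_).differentiableWithinAt
    refine DifferentiableAt.comp (g := mellin (charSum χ)) (f := fun s => -s) z ?_ (by fun_prop)
    refine mellin_differentiableAt_of_isBigO_rpow (a := 0) (b := -z.re - 1) ?_ ?_ ?_ ?_ ?_
    · have : LocallyIntegrable (charSum χ) := by
        refine (locallyIntegrable_const (N : ℝ)).mono (measurable_charSum χ).aestronglyMeasurable ?_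
        filter_upwards with t
        simpa using hbd t
      exact this.locallyIntegrableOn _
    · simp only [neg_zero, Real.rpow_zero]
      exact Asymptotics.isBigO_of_le' (c := N) _ fun t => by simpa using hbd t
    · simpa using hz'
    · refine Asymptotics.IsBigO.of_bound 1 ?_
      filter_upwards [mem_nhdsWithin_of_mem_nhds (Iio_mem_nhds (zero_lt_one (α := ℝ)))] with t ht
      rw [charSum_of_lt_one χ ht]; simp
    · simp
  have hd2 : DifferentiableOn ℂ χ.LFunction U :=
    (DirichletCharacter.differentiable_LFunction hχ).differentiableOn
  have heq : χ.LFunction =ᶠ[𝓝 (2 : ℂ)] fun s => s * mellin (charSum χ) (-s) := by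
    have : {z : ℂ | 1 < z.re} ∈ 𝓝 (2 : ℂ) :=
      (isOpen_lt continuous_const continuous_re).mem_nhds (by simp)
    filter_upwards [this] with z hz
    have hz : 1 < z.re := hz
    rw [DirichletCharacter.LFunction_eq_LSeries _ hz, mellin_charSum]
    refine LSeries_eq_mul_integral (r := 0) _ le_rfl (by linarith)
      (DirichletCharacter.LSeriesSummable_of_one_lt_re χ hz) ?_
    simp only [Real.rpow_zero]
    exact Asymptotics.isBigO_of_le' (c := N) _ fun n => by simpa using norm_sum_Icc_char_le hχ n
  have := (hd2.analyticOnNhd hUo).eqOn_of_preconnected_of_eventuallyEq (hd.analyticOnNhd hUo)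
    (convex_halfSpace_re_gt 0).isPreconnected (z₀ := 2) (by simp [hU]) heq
  rw [← mellin_charSum]
  exact this hs

lemma norm_LFunction_le {N : ℕ} [NeZero N] {χ : DirichletCharacter ℂ N} (hχ : χ ≠ 1)
    {s : ℂ} (hs : 0 < s.re) : ‖χ.LFunction s‖ ≤ N * ‖s‖ / s.re := by
  rw [LFunction_eq_mul_integral hχ hs, norm_mul]
  have hInt := (integrableOn_Ioi_rpow_of_lt (a := -(s.re + 1)) (by linarith) one_pos)
  have h1 : ‖∫ t in Ioi (1 : ℝ), charSum χ t * (t : ℂ) ^ (-(s + 1))‖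
      ≤ ∫ t in Ioi (1 : ℝ), (N : ℝ) * t ^ (-(s.re + 1)) := by
    refine norm_integral_le_of_norm_le (hInt.const_mul _) ?_
    filter_upwards [ae_restrict_mem measurableSet_Ioi] with t ht
    have ht : 1 < t := ht
    rw [norm_mul, norm_cpow_eq_rpow_re_of_pos (by linarith)]
    simp only [neg_re, add_re, one_re]
    gcongr
    exact norm_sum_Icc_char_le hχ _
  rw [integral_const_mul, integral_Ioi_rpow_of_lt (by linarith) one_pos] at h1
  have h2 : (N : ℝ) * (-(1 : ℝ) ^ (-(s.re + 1) + 1) / (-(s.re + 1) + 1)) = N / s.re := by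
    rw [Real.one_rpow]; rw [show -(s.re + 1) + 1 = -s.re by ring, neg_div_neg_eq]; ring
  rw [h2] at h1
  calc _ ≤ ‖s‖ * (N / s.re) := by gcongr
    _ = _ := by ring

lemma norm_LFunction_two_ge {N : ℕ} [NeZero N] (χ : DirichletCharacter ℂ N) (t : ℝ) :
    1 / 4 ≤ ‖χ.LFunction (2 + t * I)‖ := by
  have hre : (2 + t * I : ℂ).re = 2 := by simp
  have h1 : (1 : ℝ) < (2 + t * I : ℂ).re := by rw [hre]; norm_num
  rw [DirichletCharacter.LFunction_eq_LSeries _ h1]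
  have hsum := DirichletCharacter.LSeriesSummable_of_one_lt_re χ h1
  set f := LSeries.term (fun n => χ n) (2 + t * I) with hf
  have hs2 : Summable fun n : ℕ => 1 / (n : ℝ) ^ 2 := hasSum_zeta_two.summable
  have hfb : ∀ n, ‖f n‖ ≤ 1 / (n : ℝ) ^ 2 := by
    intro n
    rcases eq_or_ne n 0 with rfl | hn
    · simp [hf]
    · have hn' : (0 : ℝ) < n := by positivity
      rw [hf, LSeries.norm_term_eq, if_neg hn, hre]
      norm_cast
      gcongr
      exact DirichletCharacter.norm_le_one χ _
  have hf01 : f 0 + f 1 = 1 := by simp [hf]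
  have e1 : LSeries (fun n => χ n) (2 + t * I) = 1 + ∑' n, f (n + 2) := by
    rw [LSeries, ← hsum.sum_add_tsum_nat_add 2]
    rw [← hf, Finset.sum_range_succ, Finset.sum_range_one, hf01]
  have e2 : ‖∑' n, f (n + 2)‖ ≤ ∑' n : ℕ, 1 / ((n + 2 : ℕ) : ℝ) ^ 2 :=
    tsum_of_norm_bounded ((summable_nat_add_iff 2).2 hs2).hasSum fun n => hfb _
  have e3 : ∑' n : ℕ, 1 / ((n + 2 : ℕ) : ℝ) ^ 2 = Real.pi ^ 2 / 6 - 1 := by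
    have := hs2.sum_add_tsum_nat_add 2
    rw [hasSum_zeta_two.tsum_eq] at this
    simp only [Finset.sum_range_succ, Finset.sum_range_zero] at this
    norm_num at this ⊢
    linarith
  have hpi : Real.pi ^ 2 / 6 - 1 ≤ 3 / 4 := by
    nlinarith [Real.pi_lt_d2, Real.pi_gt_three]
  rw [e1]
  have := norm_sub_le_norm_add (1 : ℂ) (∑' n, f (n + 2))
  rw [norm_one] at this
  linarith

lemma LFunction_ne_zero_of_GRH
    (hG : ∀ (N : ℕ) [NeZero N] (χ : DirichletCharacter ℂ N) (s : ℂ),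
      0 < s.re → s.re < 1 → DirichletCharacter.LFunction χ s = 0 → s.re = 1 / 2)
    {N : ℕ} [NeZero N] {χ : DirichletCharacter ℂ N} (hχ : χ ≠ 1) {s : ℂ} (hs : 1 / 2 < s.re) :
    χ.LFunction s ≠ 0 := by
  intro h
  rcases lt_or_ge s.re 1 with h1 | h1
  · have := hG N χ s (by linarith) h1 h
    linarith
  · exact DirichletCharacter.LFunction_ne_zero_of_one_le_re χ (.inl hχ) h1 h

/-- Borel–Carathéodory bound for the logarithmic derivative of a zero-free function. -/
lemma norm_logDeriv_le {f : ℂ → ℂ} {c : ℂ} {r R M : ℝ} (hr : 0 < r) (hrR : r < R) (hM : 0 < M)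
    (hf : DifferentiableOn ℂ f (Metric.ball c R)) (h0 : ∀ z ∈ Metric.ball c R, f z ≠ 0)
    (hb : ∀ z ∈ Metric.ball c R, ‖f z‖ ≤ Real.exp M * ‖f c‖) {z : ℂ} (hz : ‖z - c‖ ≤ r) :
    ‖deriv f z / f z‖ ≤ 8 * R / (R - r) ^ 2 * M := by
  have hR : 0 < R := hr.trans hrR
  have hc : c ∈ Metric.ball c R := Metric.mem_ball_self hR
  have hd : DifferentiableOn ℂ (fun z => deriv f z / f z) (Metric.ball c R) :=
    (hf.deriv Metric.isOpen_ball).div hf h0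
  obtain ⟨g, hgc, hg⟩ := hd.isExactOn_ball.with_val_at c 0
  have hfat : ∀ z ∈ Metric.ball c R, HasDerivAt f (deriv f z) z := fun z hz =>
    (hf.differentiableAt (Metric.isOpen_ball.mem_nhds hz)).hasDerivAt
  have hconst : ∀ z ∈ Metric.ball c R, f z * exp (-g z) = f c := by
    have hder : ∀ z ∈ Metric.ball c R, HasDerivAt (fun z => f z * exp (-g z)) 0 z := by
      intro z hz
      refine ((hfat z hz).mul (hg z hz).neg.cexp).congr_deriv ?_
      rw [Pi.neg_apply]
      have := h0 z hz
      field_simp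
      ring
    intro z hz
    have := Metric.isOpen_ball.is_const_of_deriv_eq_zero
      (convex_ball c R).isPreconnected
      (fun z hz => (hder z hz).differentiableAt.differentiableWithinAt)
      (fun z hz => (hder z hz).deriv) hz hc
    simpa [hgc] using this
  have hre : ∀ z ∈ Metric.ball c R, (g z).re ≤ M := by
    intro z hz
    have h1 : f z = f c * exp (g z) := by
      rw [← hconst z hz, mul_assoc, ← exp_add]; simp
    have h2 := hb z hz
    rw [h1, norm_mul, norm_exp, mul_comm] at h2
    have := le_of_mul_le_mul_right h2 (norm_pos_iff.2 (h0 c hc))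
    exact Real.exp_le_exp.1 this
  have hgd : DifferentiableOn ℂ (fun w => g (w + c)) (Metric.ball 0 R) := by
    intro w hw
    have hw' : w + c ∈ Metric.ball c R := by simpa using hw
    exact ((hg _ hw').differentiableAt.comp w (by fun_prop)).differentiableWithinAt
  set r' := (r + R) / 2 with hr'
  have hbound : ∀ w, ‖w - c‖ ≤ r' → ‖g w‖ ≤ 2 * M * R / ((R - r) / 2) := by
    intro w hw
    have hwR : ‖w - c‖ < R := by linarith
    have := borelCaratheodory_zero (f := fun w => g (w + c)) hM hgd
      (by intro w hw; exact hre _ (by simpa using hw)) hR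
      (z := w - c) (by simpa using hwR) (by simpa using hgc)
    simp only [sub_add_cancel] at this
    refine this.trans ?_
    have h1 : 0 < (R - r) / 2 := by linarith
    gcongr
    linarith
  have hzb : z ∈ Metric.ball c R := by
    rw [Metric.mem_ball, dist_eq_norm]; linarith
  rw [← (hg z hzb).deriv]
  have hρ : 0 < (R - r) / 2 := by linarith
  have hin : ∀ w ∈ Metric.closedBall z ((R - r) / 2), ‖w - c‖ ≤ r' := by
    intro w hw
    rw [Metric.mem_closedBall, dist_eq_norm] at hw
    calc ‖w - c‖ = ‖(w - z) + (z - c)‖ := by ring_nf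
      _ ≤ _ := norm_add_le _ _
      _ ≤ r' := by linarith
  have := norm_deriv_le_of_forall_mem_sphere_norm_le (f := g) (c := z) hρ
    (C := 2 * M * R / ((R - r) / 2)) ?_ ?_
  · refine this.trans (le_of_eq ?_)
    have : R - r ≠ 0 := by linarith
    field_simp
    ring
  · refine DifferentiableOn.diffContOnCl_ball (U := Metric.ball c R) ?_ ?_
    · exact fun w hw => (hg w hw).differentiableAt.differentiableWithinAt
    · intro w hw
      have := hin w hw
      rw [Metric.mem_ball, dist_eq_norm]; linarith
  · intro w hw
    exact hbound w (hin w (Metric.sphere_subset_closedBall hw))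

/-- The analytic conductor of `L(s, χ)` at height `t` for a character modulo `N`. -/
def conductor (N : ℕ) (t : ℝ) : ℝ := N * (|t| + 2)

lemma two_le_conductor (N : ℕ) [NeZero N] (t : ℝ) : 2 ≤ conductor N t := by
  have h : (1 : ℝ) ≤ N := by exact_mod_cast NeZero.one_le
  unfold conductor
  nlinarith [abs_nonneg t]

lemma norm_logDeriv_LFunction_le
    (hG : ∀ (N : ℕ) [NeZero N] (χ : DirichletCharacter ℂ N) (s : ℂ),
      0 < s.re → s.re < 1 → DirichletCharacter.LFunction χ s = 0 → s.re = 1 / 2)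
    {η : ℝ} (hη : 0 < η) (hη1 : η < 1 / 2) :
    ∃ C > 0, ∀ (N : ℕ) [NeZero N] (χ : DirichletCharacter ℂ N), χ ≠ 1 → ∀ s : ℂ,
      1 / 2 + η ≤ s.re → s.re ≤ 2 →
      ‖deriv χ.LFunction s / χ.LFunction s‖ ≤ C * Real.log (conductor N s.im) := by
  have hl2 : 0 < Real.log 2 := Real.log_pos (by norm_num)
  refine ⟨8 * (3 / 2) / (3 / 2 - (3 / 2 - η)) ^ 2 * (1 + 5), by
    have : 0 < 3 / 2 - (3 / 2 - η) := by linarith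
    positivity, ?_⟩
  intro N _ χ hχ s hs hs2
  have hN : (1 : ℝ) ≤ N := by exact_mod_cast NeZero.one_le
  set t := s.im with ht
  have hQ := two_le_conductor N t
  have hlQ : Real.log 2 ≤ Real.log (conductor N t) := Real.log_le_log (by norm_num) hQ
  have hc2 : ∀ z ∈ Metric.ball (2 + t * I : ℂ) (3 / 2), 1 / 2 < z.re ∧ ‖z‖ ≤ 2 * (|t| + 2) := by
    intro z hz
    rw [Metric.mem_ball, dist_eq_norm] at hz
    constructor
    · have := (abs_re_le_norm (z - (2 + t * I))).trans_lt hz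
      simp only [sub_re, add_re, re_ofNat, mul_re, ofReal_re, I_re, mul_zero, ofReal_im, I_im,
        mul_one, sub_self, add_zero] at this
      have := (abs_lt.1 this).1
      linarith
    · have h1 : ‖(2 + t * I : ℂ)‖ ≤ 2 + |t| := by
        refine (norm_add_le _ _).trans ?_
        simp
      have h2 := norm_le_norm_add_norm_sub' z (2 + t * I)
      nlinarith [abs_nonneg t]
  have := norm_logDeriv_le (f := χ.LFunction) (c := 2 + t * I) (r := 3 / 2 - η) (R := 3 / 2)
    (M := (1 + 5) * Real.log (conductor N t)) (by linarith) (by linarith)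
    (by have := hl2.trans_le hlQ; positivity)
    (DirichletCharacter.differentiable_LFunction hχ).differentiableOn
    (fun z hz => LFunction_ne_zero_of_GRH hG hχ (hc2 z hz).1) ?_ (z := s) ?_
  · simpa only [mul_assoc] using this
  · intro z hz
    obtain ⟨h1, h2⟩ := hc2 z hz
    have h3 : ‖χ.LFunction z‖ ≤ 4 * conductor N t := by
      refine (norm_LFunction_le hχ (by linarith)).trans ?_
      rw [div_le_iff₀ (by linarith)]
      unfold conductor
      calc (N : ℝ) * ‖z‖ ≤ N * (2 * (|t| + 2)) := by gcongr
        _ = 4 * (N * (|t| + 2)) * (1 / 2) := by ring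
        _ ≤ _ := by gcongr
    have h4 := norm_LFunction_two_ge χ t
    have h5 : Real.exp ((1 + 5) * Real.log (conductor N t)) = conductor N t ^ 6 := by
      rw [← Real.rpow_natCast, Real.rpow_def_of_pos (by linarith)]
      congr 1; push_cast; ring
    rw [h5]
    have h6 : (2 : ℝ) ^ 5 ≤ conductor N t ^ 5 := by gcongr
    have h7 : 32 * conductor N t ≤ conductor N t ^ 6 := by
      calc 32 * conductor N t = 2 ^ 5 * conductor N t := by norm_num
        _ ≤ conductor N t ^ 5 * conductor N t := by gcongr
        _ = _ := by ring
    have h8 : 0 ≤ conductor N t ^ 6 := by positivity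
    nlinarith
  · have : s - (2 + t * I) = ((s.re - 2 : ℝ) : ℂ) := by
      apply Complex.ext <;> simp [ht]
    rw [this, norm_real, Real.norm_eq_abs, abs_le]
    constructor <;> linarith

/-- Moving a vertical line of integration across a strip. -/
lemma integral_vertical_eq {f : ℂ → ℂ} {a c : ℝ} (hac : a < c)
    (hcont : ContinuousOn f {w | w.re ∈ Icc a c})
    (hd : ∀ w : ℂ, a < w.re → w.re < c → w ≠ 0 → DifferentiableAt ℂ f w)
    (ha : Integrable fun v : ℝ => f (a + v * I)) (hc : Integrable fun v : ℝ => f (c + v * I))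
    {K : ℝ} (hK : ∀ w : ℂ, a ≤ w.re → w.re ≤ c → 1 ≤ |w.im| → ‖f w‖ ≤ K / |w.im|) :
    ∫ v : ℝ, f (a + v * I) = ∫ v : ℝ, f (c + v * I) := by
  have h1 := intervalIntegral_tendsto_integral ha tendsto_neg_atTop_atBot tendsto_id
  have h2 := intervalIntegral_tendsto_integral hc tendsto_neg_atTop_atBot tendsto_id
  have hrect : ∀ T : ℝ, 1 ≤ T →
      ‖(∫ v in (-T)..T, f (c + v * I)) - ∫ v in (-T)..T, f (a + v * I)‖
        ≤ 2 * (K / T * (c - a)) := by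
    intro T hT
    have := integral_boundary_rect_eq_zero_of_differentiable_on_off_countable f
      (a + (-T : ℝ) * I) (c + T * I) {0} (countable_singleton 0) ?_ ?_
    · simp only [add_re, ofReal_re, mul_re, I_re, mul_zero, ofReal_im, I_im, mul_one, sub_self,
        add_zero, add_im, mul_im, zero_add, smul_eq_mul] at this
      have hside : ∀ τ : ℝ, |τ| = T → ‖∫ x in a..c, f (x + τ * I)‖ ≤ K / T * (c - a) := by
        intro τ hτ
        have := intervalIntegral.norm_integral_le_of_norm_le_const (a := a) (b := c)
          (f := fun x : ℝ => f (x + τ * I)) (C := K / T) ?_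
        · rwa [abs_of_pos (by linarith)] at this
        · intro x hx
          rw [uIoc_of_le hac.le] at hx
          have := hK (x + τ * I) (by simpa using hx.1.le) (by simpa using hx.2)
            (by simpa [hτ] using hT)
          simpa [hτ] using this
      have e : (∫ v in (-T)..T, f (c + v * I)) - ∫ v in (-T)..T, f (a + v * I)
          = I * ((∫ x in a..c, f (x + (-T : ℝ) * I)) - ∫ x in a..c, f (x + T * I)) := by
        linear_combination (-I) * this +
          ((∫ v in (-T)..T, f (c + v * I)) - ∫ v in (-T)..T, f (a + v * I)) * (I_mul_I)
      rw [e, norm_mul, norm_I, one_mul]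
      refine (norm_sub_le _ _).trans ?_
      have := hside (-T) (by rw [abs_neg, abs_of_pos (by linarith)])
      have := hside T (by rw [abs_of_pos (by linarith)])
      linarith
    · refine hcont.mono ?_
      intro w hw
      have := hw.1
      simp only [mem_preimage, add_re, ofReal_re, mul_re, I_re, mul_zero, ofReal_im, I_im,
        mul_one, sub_self, add_zero] at this
      rwa [uIcc_of_le hac.le] at this
    · intro w hw
      have := hw.1.1
      simp only [mem_preimage, add_re, ofReal_re, mul_re, I_re, mul_zero, ofReal_im, I_im,
        mul_one, sub_self, add_zero] at this
      rw [min_eq_left hac.le, max_eq_right hac.le] at this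
      exact hd w this.1 this.2 (by simpa using hw.2)
  have h3 := (h2.sub h1)
  have h4 : Tendsto (fun T : ℝ => (∫ v in (-T)..T, f (c + v * I)) -
      ∫ v in (-T)..T, f (a + v * I)) atTop (𝓝 0) := by
    refine squeeze_zero_norm' ((eventually_ge_atTop 1).mono fun T hT => hrect T hT) ?_
    have : Tendsto (fun T : ℝ => 2 * (K / T * (c - a))) atTop (𝓝 (2 * (0 * (c - a)))) :=
      ((tendsto_const_nhds.div_atTop tendsto_id).mul_const _).const_mul _
    simpa using this
  exact (sub_eq_zero.1 (tendsto_nhds_unique h3 h4)).symm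

lemma one_add_sq_le_norm_sq {σ : ℝ} (hσ : 0 < σ) (hσ1 : σ ≤ 1) {w : ℂ} (h : σ ≤ |w.re|) :
    σ * (1 + w.im ^ 2) ^ (1 / 2 : ℝ) ≤ ‖w‖ := by
  rw [← Real.sqrt_eq_rpow]
  have h1 : ‖w‖ ^ 2 = w.re ^ 2 + w.im ^ 2 := by
    rw [← normSq_eq_norm_sq, normSq_apply]; ring
  have h2 : σ ^ 2 ≤ w.re ^ 2 := by rw [← sq_abs w.re]; gcongr
  have h3 : σ ^ 2 * (1 + w.im ^ 2) ≤ ‖w‖ ^ 2 := by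
    rw [h1]; nlinarith [sq_nonneg w.im, mul_nonneg hσ.le (sq_nonneg w.im)]
  refine abs_le_of_sq_le_sq' ?_ (norm_nonneg _) |>.2
  rw [mul_pow, Real.sq_sqrt (by positivity)]
  exact h3

lemma ne_zero_of_re_ne_zero {w : ℂ} (h : w.re ≠ 0) : w ≠ 0 := by
  rintro rfl; simp at h

lemma integrable_perron : Integrable fun v : ℝ =>
    1 / ((((1 : ℝ) : ℂ) + v * I) * (((1 : ℝ) : ℂ) + v * I + 1)) := by
  have hInt : Integrable fun v : ℝ => (1 + v ^ 2)⁻¹ := integrable_inv_one_add_sq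
  refine hInt.mono' ?_ ?_
  · refine Continuous.aestronglyMeasurable ?_
    refine continuous_const.div (by fun_prop) fun v => mul_ne_zero ?_ ?_ <;>
    exact ne_zero_of_re_ne_zero (by norm_num)
  · filter_upwards with v
    have h1 := one_add_sq_le_norm_sq one_pos le_rfl (w := ((1 : ℝ) : ℂ) + v * I) (by simp)
    have h2 := one_add_sq_le_norm_sq one_pos le_rfl (w := ((1 : ℝ) : ℂ) + v * I + 1) (by norm_num)
    have e1 : (((1 : ℝ) : ℂ) + v * I).im = v := by simp
    have e2 : (((1 : ℝ) : ℂ) + v * I + 1).im = v := by simp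
    rw [e1, one_mul] at h1
    rw [e2, one_mul] at h2
    rw [norm_div, norm_one, norm_mul, one_div]
    have hpos : (0 : ℝ) < 1 + v ^ 2 := by positivity
    gcongr
    calc 1 + v ^ 2 = (1 + v ^ 2) ^ (1 / 2 : ℝ) * (1 + v ^ 2) ^ (1 / 2 : ℝ) := by
          rw [← Real.rpow_add hpos]; norm_num
      _ ≤ _ := by gcongr

/-- The smoothed Perron formula. -/
lemma integral_perron {u : ℝ} (hu : 0 < u) :
    ∫ v : ℝ, (u : ℂ) ^ (((1 : ℝ) : ℂ) + v * I + 1) /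
      ((((1 : ℝ) : ℂ) + v * I) * (((1 : ℝ) : ℂ) + v * I + 1)) =
      ((2 * Real.pi * max (u - 1) 0 : ℝ) : ℂ) := by
  set f : ℝ → ℂ := fun t => ((max (1 - t) 0 : ℝ) : ℂ) with hf
  have hm : ∀ w : ℂ, 0 < w.re → HasMellin (f) w (1 / (w * (w + 1))) := by
    intro w hw
    have hw0 : w ≠ 0 := ne_zero_of_re_ne_zero hw.ne'
    have hw1 : w + 1 ≠ 0 := ne_zero_of_re_ne_zero (by simp; linarith)
    have h1 := hasMellin_one_Ioc hw
    have h2 := hasMellin_cpow_Ioc 1 (s := w) (by simp; linarith)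
    have h3 := hasMellin_sub h1.1 h2.1
    rw [h1.2, h2.2] at h3
    have heq : EqOn (fun t => indicator (Ioc 0 1) (fun _ => (1 : ℂ)) t -
        indicator (Ioc 0 1) (fun t : ℝ => (t : ℂ) ^ (1 : ℂ)) t) f (Ioi 0) := by
      intro t ht
      have ht : 0 < t := ht
      by_cases h : t ≤ 1
      · simp [hf, indicator, ht, h]
      · simp [hf, indicator, h, (not_le.1 h).le]
    have e : 1 / (w * (w + 1)) = 1 / w - 1 / (w + 1) := by field_simp; ring
    rw [e]
    refine ⟨?_, ?_⟩
    · have := h3.1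
      rw [MellinConvergent] at this ⊢
      refine this.congr_fun ?_ measurableSet_Ioi
      intro t ht
      exact congrArg _ (heq ht)
    · rw [← h3.2, mellin, mellin]
      refine setIntegral_congr_fun measurableSet_Ioi fun t ht => ?_
      exact congrArg _ (heq ht).symm
  have hre : ∀ v : ℝ, 0 < (((1 : ℝ) : ℂ) + v * I).re := by simp
  have hx : 0 < u⁻¹ := by positivity
  have := mellinInv_mellin_eq 1 f hx (hm _ (by simp)).1 ?_ ?_
  · rw [mellinInv] at this
    have e : ∀ v : ℝ, (u : ℂ) ^ (((1 : ℝ) : ℂ) + v * I + 1) /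
      ((((1 : ℝ) : ℂ) + v * I) * (((1 : ℝ) : ℂ) + v * I + 1)) =
      u * (((u⁻¹ : ℝ) : ℂ) ^ (-(((1 : ℝ) : ℂ) + v * I)) • mellin f (((1 : ℝ) : ℂ) + v * I)) := by
      intro v
      rw [(hm _ (hre v)).2, ofReal_inv, inv_cpow _ _ (by rw [arg_ofReal_of_nonneg hu.le]; exact Real.pi_pos.ne),
        cpow_neg, inv_inv, cpow_add _ _ (by exact_mod_cast hu.ne'), cpow_one, smul_eq_mul]
      ring
    simp_rw [e]
    rw [integral_const_mul]
    have h2 : ∫ v : ℝ, ((u⁻¹ : ℝ) : ℂ) ^ (-(((1 : ℝ) : ℂ) + v * I)) • mellin f (((1 : ℝ) : ℂ) + v * I)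
        = 2 * Real.pi * f u⁻¹ := by
      rw [← this, real_smul, ← mul_assoc]
      have : (2 * Real.pi * ((1 / (2 * Real.pi) : ℝ) : ℂ)) = 1 := by
        have := Real.pi_ne_zero
        push_cast
        field_simp
      rw [this, one_mul]
    rw [h2, hf]
    have : max (u - 1) 0 = u * max (1 - u⁻¹) 0 := by
      rw [mul_max_of_nonneg _ _ hu.le]; field_simp; simp
    rw [this]
    push_cast
    ring
  · refine integrable_perron.congr ?_
    filter_upwards with v
    rw [(hm _ (hre v)).2]
  · refine Continuous.continuousAt ?_
    fun_prop

/-- A Perron kernel that detects `n ≤ y` with a linear cut-off between `y` and `y + h`. -/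
def perronKernel (y h : ℝ) (w : ℂ) : ℂ :=
  (((y + h : ℝ) : ℂ) ^ (w + 1) - (y : ℂ) ^ (w + 1)) / (h * (w * (w + 1)))

/-- The linear cut-off between `y` and `y + h`. -/
def cutoff (y h t : ℝ) : ℝ := (max (y + h - t) 0 - max (y - t) 0) / h

lemma cutoff_of_le {y h t : ℝ} (hh : 0 < h) (ht : t ≤ y) : cutoff y h t = 1 := by
  rw [cutoff, max_eq_left (by linarith), max_eq_left (by linarith)]
  field_simp; ring

lemma cutoff_of_ge {y h t : ℝ} (hh : 0 < h) (ht : y + h ≤ t) : cutoff y h t = 0 := by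
  rw [cutoff, max_eq_right (by linarith), max_eq_right (by linarith)]
  simp

lemma cutoff_nonneg {y h t : ℝ} (hh : 0 < h) : 0 ≤ cutoff y h t := by
  rw [cutoff]
  have : max (y - t) 0 ≤ max (y + h - t) 0 := by gcongr; linarith
  have : 0 ≤ max (y + h - t) 0 - max (y - t) 0 := by linarith
  positivity

lemma cutoff_le_one {y h t : ℝ} (hh : 0 < h) : cutoff y h t ≤ 1 := by
  rw [cutoff, div_le_one hh]
  have : max (y + h - t) 0 ≤ max (y - t) 0 + h := by
    refine max_le ?_ ?_
    · linarith [le_max_left (y - t) 0]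
    · linarith [le_max_right (y - t) 0]
  linarith

lemma integrable_cpow_perron {u : ℝ} (hu : 0 < u) :
    Integrable fun v : ℝ => (u : ℂ) ^ (((1 : ℝ) : ℂ) + v * I + 1) /
      ((((1 : ℝ) : ℂ) + v * I) * (((1 : ℝ) : ℂ) + v * I + 1)) := by
  have : ∀ v : ℝ, (u : ℂ) ^ (((1 : ℝ) : ℂ) + v * I + 1) /
      ((((1 : ℝ) : ℂ) + v * I) * (((1 : ℝ) : ℂ) + v * I + 1)) =
      (u : ℂ) ^ (((1 : ℝ) : ℂ) + v * I + 1) *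
      (1 / ((((1 : ℝ) : ℂ) + v * I) * (((1 : ℝ) : ℂ) + v * I + 1))) := fun v => by ring
  simp_rw [this]
  refine integrable_perron.bdd_mul (c := u ^ (2 : ℝ)) ?_ ?_
  · refine Continuous.aestronglyMeasurable ?_
    exact Continuous.const_cpow (by fun_prop) (Or.inl (by exact_mod_cast hu.ne'))
  · filter_upwards with v
    rw [norm_cpow_eq_rpow_re_of_pos hu]
    simp
    norm_num

lemma integral_perronKernel {y h n : ℝ} (hy : 0 < y) (hh : 0 < h) (hn : 0 < n) :
    ∫ v : ℝ, perronKernel y h (((1 : ℝ) : ℂ) + v * I) * (n : ℂ) ^ (-(((1 : ℝ) : ℂ) + v * I)) =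
      ((2 * Real.pi * cutoff y h n : ℝ) : ℂ) := by
  have e : ∀ v : ℝ, perronKernel y h (((1 : ℝ) : ℂ) + v * I) * (n : ℂ) ^ (-(((1 : ℝ) : ℂ) + v * I)) =
      (n / h : ℂ) * ((((y + h) / n : ℝ) : ℂ) ^ (((1 : ℝ) : ℂ) + v * I + 1) /
      ((((1 : ℝ) : ℂ) + v * I) * (((1 : ℝ) : ℂ) + v * I + 1)) -
      ((y / n : ℝ) : ℂ) ^ (((1 : ℝ) : ℂ) + v * I + 1) /
      ((((1 : ℝ) : ℂ) + v * I) * (((1 : ℝ) : ℂ) + v * I + 1))) := by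
    intro v
    set w := ((1 : ℝ) : ℂ) + v * I
    have hn0 : (n : ℂ) ≠ 0 := by exact_mod_cast hn.ne'
    have key : ∀ z : ℝ, 0 < z → ((z / n : ℝ) : ℂ) ^ (w + 1) = (z : ℂ) ^ (w + 1) * n ^ (-w) / n := by
      intro z hz
      rw [ofReal_div, div_eq_mul_inv, ← ofReal_inv, mul_cpow_ofReal_nonneg hz.le (by positivity),
        ofReal_inv, inv_cpow _ _ (by rw [arg_ofReal_of_nonneg hn.le]; exact Real.pi_pos.ne),
        ← cpow_neg, neg_add, cpow_add _ _ hn0, cpow_neg_one]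
      ring
    rw [key _ (by linarith), key _ hy, perronKernel]
    have : (h : ℂ) ≠ 0 := by exact_mod_cast hh.ne'
    field_simp
  simp_rw [e]
  have h1 : 0 < (y + h) / n := by positivity
  have h2 : 0 < y / n := by positivity
  rw [integral_const_mul, integral_sub (integrable_cpow_perron h1) (integrable_cpow_perron h2),
    integral_perron h1, integral_perron h2, cutoff]
  have m1 : ∀ z, max (z - n) 0 = n * max (z / n - 1) 0 := by
    intro z
    rw [mul_max_of_nonneg _ _ hn.le]; field_simp; simp
  rw [m1, m1]
  push_cast
  ring

lemma integrable_perronKernel {y h : ℝ} (hy : 0 < y) (hh : 0 < h) :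
    Integrable fun v : ℝ => perronKernel y h (((1 : ℝ) : ℂ) + v * I) := by
  have := ((integrable_cpow_perron (u := y + h) (by linarith)).sub
    (integrable_cpow_perron hy)).const_mul (1 / h : ℂ)
  refine this.congr ?_
  filter_upwards with v
  simp only [perronKernel, Pi.sub_apply]
  rw [← sub_div, div_mul_div_comm, one_mul]

/-- Perron's formula for an absolutely convergent Dirichlet series. -/
lemma integral_LSeries_mul_perronKernel {y h : ℝ} (hy : 0 < y) (hh : 0 < h) {a : ℕ → ℂ}
    (ha : LSeriesSummable a 1) :
    ∫ v : ℝ, LSeries a (((1 : ℝ) : ℂ) + v * I) * perronKernel y h (((1 : ℝ) : ℂ) + v * I) =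
      2 * Real.pi * ∑' n : ℕ, (if n = 0 then 0 else a n * (cutoff y h n : ℂ)) := by
  have hK := integrable_perronKernel hy hh
  have hterm : ∀ (n : ℕ) (v : ℝ), LSeries.term a (((1 : ℝ) : ℂ) + v * I) n *
      perronKernel y h (((1 : ℝ) : ℂ) + v * I) = if n = 0 then 0 else
      a n * (perronKernel y h (((1 : ℝ) : ℂ) + v * I) * ((n : ℝ) : ℂ) ^ (-(((1 : ℝ) : ℂ) + v * I))) := by
    intro n v
    rw [LSeries.term_def]
    split_ifs with hn
    · simp
    · rw [cpow_neg]; push_cast; ring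
  have hnorm : ∀ (n : ℕ) (v : ℝ), ‖LSeries.term a (((1 : ℝ) : ℂ) + v * I) n‖ = ‖LSeries.term a 1 n‖ := by
    intro n v
    rw [LSeries.norm_term_eq, LSeries.norm_term_eq]
    simp
  have hmeas : ∀ n : ℕ, Continuous fun v : ℝ => LSeries.term a (((1 : ℝ) : ℂ) + v * I) n := by
    intro n
    simp_rw [LSeries.term_def]
    split_ifs with hn
    · exact continuous_const
    · refine continuous_const.div ?_ ?_
      · exact Continuous.const_cpow (by fun_prop) (Or.inl (by exact_mod_cast hn))
      · intro v; simp [cpow_eq_zero_iff, hn]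
  have hI : ∀ n : ℕ, Integrable fun v : ℝ => LSeries.term a (((1 : ℝ) : ℂ) + v * I) n *
      perronKernel y h (((1 : ℝ) : ℂ) + v * I) := by
    intro n
    refine hK.bdd_mul (c := ‖LSeries.term a 1 n‖) (hmeas n).aestronglyMeasurable ?_
    filter_upwards with v using (hnorm n v).le
  have hsum := hasSum_integral_of_summable_integral_norm hI ?_
  · have e1 : ∀ v : ℝ, ∑' n, LSeries.term a (((1 : ℝ) : ℂ) + v * I) n *
        perronKernel y h (((1 : ℝ) : ℂ) + v * I) =
        LSeries a (((1 : ℝ) : ℂ) + v * I) * perronKernel y h (((1 : ℝ) : ℂ) + v * I) := by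
      intro v; rw [tsum_mul_right, LSeries]
    simp_rw [e1] at hsum
    rw [← hsum.tsum_eq, ← tsum_mul_left]
    refine tsum_congr fun n => ?_
    simp_rw [hterm]
    split_ifs with hn
    · simp
    · rw [integral_const_mul, integral_perronKernel hy hh (by positivity)]
      push_cast; ring
  · simp_rw [norm_mul, hnorm, integral_const_mul]
    exact (ha.norm).mul_right _

lemma two_add_log_le {b : ℝ} (hb : 0 < b) (v : ℝ) :
    2 + Real.log (1 + |v|) ≤ (3 + 4 / b) * (1 + v ^ 2) ^ (b / 4) := by
  have h1 : (1 : ℝ) ≤ 1 + v ^ 2 := by nlinarith [sq_nonneg v]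
  have h2 : 1 + |v| ≤ 2 * (1 + v ^ 2) := by
    rw [← sq_abs v]; nlinarith [sq_nonneg (|v| - 1), abs_nonneg v]
  have h3 : Real.log (1 + |v|) ≤ 1 + Real.log (1 + v ^ 2) := by
    refine (Real.log_le_log (by positivity) h2).trans ?_
    rw [Real.log_mul (by norm_num) (by positivity)]
    linarith [Real.log_two_lt_d9]
  have h4 : Real.log (1 + v ^ 2) ≤ (1 + v ^ 2) ^ (b / 4) / (b / 4) :=
    Real.log_le_rpow_div (by positivity) (by positivity)
  have h5 : 1 ≤ (1 + v ^ 2) ^ (b / 4) := Real.one_le_rpow h1 (by positivity)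
  have h6 : (1 + v ^ 2) ^ (b / 4) / (b / 4) = 4 / b * (1 + v ^ 2) ^ (b / 4) := by field_simp
  nlinarith

lemma integrable_weight {b : ℝ} (hb : 0 < b) :
    Integrable fun v : ℝ => (1 + v ^ 2) ^ (-(1 + b / 2) / 2) := by
  have := integrable_rpow_neg_one_add_norm_sq (E := ℝ) (μ := volume) (r := 1 + b / 2)
    (by simp; positivity)
  simpa using this

lemma norm_perronKernel_le_of_re_le_one {y h : ℝ} (hy : 1 ≤ y) (hh : 0 < h) {w : ℂ}
    (h2 : w.re ≤ 1) :
    ‖perronKernel y h w‖ ≤ 2 * (y + h) ^ 2 / h / (‖w‖ * ‖w + 1‖) := by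
  have hp : ∀ z : ℝ, 1 ≤ z → z ≤ y + h → ‖(z : ℂ) ^ (w + 1)‖ ≤ (y + h) ^ 2 := by
    intro z hz hz2
    rw [norm_cpow_eq_rpow_re_of_pos (by linarith)]
    calc z ^ (w + 1).re ≤ z ^ (2 : ℝ) := by
          refine Real.rpow_le_rpow_of_exponent_le hz ?_
          simp; linarith
      _ = z ^ 2 := by norm_cast
      _ ≤ _ := by gcongr
  rw [perronKernel, norm_div, norm_mul, norm_mul, norm_real, Real.norm_of_nonneg hh.le, div_div]
  gcongr
  refine (norm_sub_le _ _).trans ?_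
  linarith [hp (y + h) (by linarith) le_rfl, hp y hy (by linarith)]

lemma norm_perronKernel_le_of_re_eq_neg {b y : ℝ} (hb : 0 < b) (hb1 : b ≤ 1 / 2) (hy : 1 ≤ y)
    {w : ℂ} (hw : w.re = -b) :
    ‖perronKernel y (y ^ (1 / 2 : ℝ)) w‖ ≤
      4 / b * y ^ (-b / 2) * (1 + w.im ^ 2) ^ (-(1 + b) / 2) := by
  have hy0 : 0 < y := by linarith
  set h := y ^ (1 / 2 : ℝ) with hh
  have hh0 : 0 < h := by positivity
  have hhy : h ≤ y := by
    calc h ≤ y ^ (1 : ℝ) := Real.rpow_le_rpow_of_exponent_le hy (by norm_num)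
      _ = y := Real.rpow_one y
  have hq : 0 < 1 + w.im ^ 2 := by positivity
  set G : ℂ := ((y + h : ℝ) : ℂ) ^ (w + 1) / (w + 1) - (y : ℂ) ^ (w + 1) / (w + 1) with hG
  have hw1 := one_add_sq_le_norm_sq (σ := 1 / 2) (w := w + 1) (by norm_num) (by norm_num)
    (by simp only [add_re, hw, one_re]; rw [abs_of_pos] <;> linarith)
  have hw0 := one_add_sq_le_norm_sq (σ := b) (w := w) hb (by linarith) (by rw [hw, abs_neg, abs_of_pos hb])
  simp only [add_im, one_im, add_zero] at hw1
  have hne : w ≠ -1 := by rintro rfl; simp at hw; linarith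
  have g1 : ‖G‖ ≤ y ^ (-b) * h := by
    have := (convex_Icc y (y + h)).norm_image_sub_le_of_norm_hasDerivWithin_le
      (f := fun t : ℝ => (t : ℂ) ^ (w + 1) / (w + 1)) (f' := fun t => (t : ℂ) ^ w)
      (C := y ^ (-b)) (x := y) (y := y + h) ?_ ?_ ?_ ?_
    · rw [add_sub_cancel_left, Real.norm_of_nonneg hh0.le] at this
      exact this
    · intro t ht
      exact (hasDerivAt_ofReal_cpow_const' (hy0.trans_le ht.1).ne' hne).hasDerivWithinAt
    · intro t ht
      rw [norm_cpow_eq_rpow_re_of_pos (by linarith [ht.1]), hw]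
      exact Real.rpow_le_rpow_of_nonpos hy0 ht.1 (by linarith)
    · exact ⟨le_rfl, by linarith⟩
    · exact ⟨by linarith, le_rfl⟩
  have g2 : ‖G‖ ≤ 4 * y ^ (1 - b) / ‖w + 1‖ := by
    rw [hG, ← sub_div, norm_div]
    gcongr
    refine (norm_sub_le _ _).trans ?_
    rw [norm_cpow_eq_rpow_re_of_pos (by linarith), norm_cpow_eq_rpow_re_of_pos (by linarith)]
    simp only [add_re, hw, one_re]
    have e1 : (y + h) ^ (-b + 1) ≤ 2 * y ^ (1 - b) := by
      calc (y + h) ^ (-b + 1) ≤ (2 * y) ^ (-b + 1) := by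
            refine Real.rpow_le_rpow (by positivity) (by linarith) (by linarith)
        _ = 2 ^ (-b + 1) * y ^ (-b + 1) := Real.mul_rpow (by norm_num) hy0.le
        _ ≤ 2 ^ (1 : ℝ) * y ^ (-b + 1) := by
            gcongr
            · norm_num
            · linarith
        _ = _ := by rw [Real.rpow_one]; ring_nf
    have e2 : y ^ (-b + 1) = y ^ (1 - b) := by ring_nf
    have : 0 ≤ y ^ (1 - b) := by positivity
    linarith
  have g3 : ‖G‖ ≤ 4 * y ^ ((1 - b) / 2) * (1 + w.im ^ 2) ^ (-b / 2) := by
    have hlow : 0 < (1 / 2 : ℝ) * (1 + w.im ^ 2) ^ (1 / 2 : ℝ) := by positivity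
    have g2' : ‖G‖ ≤ 8 * (y ^ (1 - b) * (1 + w.im ^ 2) ^ (-(1 / 2) : ℝ)) := by
      refine g2.trans ?_
      calc 4 * y ^ (1 - b) / ‖w + 1‖ ≤ 4 * y ^ (1 - b) / (1 / 2 * (1 + w.im ^ 2) ^ (1 / 2 : ℝ)) := by
            gcongr
        _ = _ := by rw [Real.rpow_neg hq.le]; field_simp; norm_num
    calc ‖G‖ = ‖G‖ ^ (1 - b) * ‖G‖ ^ b := by
          rw [← Real.rpow_add' (norm_nonneg _) (by norm_num)]; simp
      _ ≤ (y ^ (-b) * h) ^ (1 - b) * (8 * (y ^ (1 - b) * (1 + w.im ^ 2) ^ (-(1 / 2) : ℝ))) ^ b := by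
          gcongr
          linarith
      _ = 8 ^ b * ((y ^ (-b) * y ^ (1 / 2 : ℝ)) ^ (1 - b) * (y ^ (1 - b)) ^ b)
            * ((1 + w.im ^ 2) ^ (-(1 / 2) : ℝ)) ^ b := by
          rw [Real.mul_rpow (x := 8) (by norm_num) (by positivity),
            Real.mul_rpow (x := y ^ (1 - b)) (by positivity) (by positivity)]; ring
      _ = 8 ^ b * y ^ ((1 - b) / 2) * (1 + w.im ^ 2) ^ (-b / 2) := by
          rw [← Real.rpow_add hy0, ← Real.rpow_mul hy0.le, ← Real.rpow_mul hy0.le,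
            ← Real.rpow_add hy0, ← Real.rpow_mul hq.le]
          ring_nf
      _ ≤ _ := by
          gcongr
          calc (8 : ℝ) ^ b ≤ 8 ^ (1 / 2 : ℝ) := Real.rpow_le_rpow_of_exponent_le (by norm_num) hb1
            _ ≤ 16 ^ (1 / 2 : ℝ) := by gcongr; norm_num
            _ = 4 := by
                rw [← Real.sqrt_eq_rpow, show (16 : ℝ) = 4 ^ 2 by norm_num,
                  Real.sqrt_sq (by norm_num)]
  have hK : perronKernel y h w = G / (h * w) := by
    rw [perronKernel, hG, ← sub_div, div_div]
    ring_nf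
  rw [hK, norm_div, norm_mul, norm_real, Real.norm_of_nonneg hh0.le]
  calc ‖G‖ / (h * ‖w‖) ≤ (4 * y ^ ((1 - b) / 2) * (1 + w.im ^ 2) ^ (-b / 2)) /
        (h * (b * (1 + w.im ^ 2) ^ (1 / 2 : ℝ))) := by gcongr
    _ = 4 / b * (y ^ ((1 - b) / 2) * y ^ (-(1 / 2) : ℝ)) *
        ((1 + w.im ^ 2) ^ (-b / 2) * (1 + w.im ^ 2) ^ (-(1 / 2) : ℝ)) := by
        rw [Real.rpow_neg hq.le (1 / 2), Real.rpow_neg hy0.le (1 / 2), hh]; field_simp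
    _ = _ := by
        rw [← Real.rpow_add hy0, ← Real.rpow_add hq]; ring_nf

/-- Shifting the contour in the smoothed Perron formula to the left of the origin. -/
lemma norm_integral_perron_shift_le {b : ℝ} (hb : 0 < b) (hb1 : b ≤ 1 / 2) :
    ∃ C > 0, ∀ (D : ℂ → ℂ) (A L y : ℝ), 0 < A → 0 ≤ L → 1 ≤ y →
      (∀ w : ℂ, -b ≤ w.re → w.re ≤ 1 → DifferentiableAt ℂ D w) →
      (∀ w : ℂ, -b ≤ w.re → w.re ≤ 1 → ‖D w‖ ≤ A * (L + Real.log (1 + |w.im|))) →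
      Integrable (fun v : ℝ => (D (((1 : ℝ) : ℂ) + v * I) - D 0) *
        perronKernel y (y ^ (1 / 2 : ℝ)) (((1 : ℝ) : ℂ) + v * I)) ∧
      ‖∫ v : ℝ, (D (((1 : ℝ) : ℂ) + v * I) - D 0) *
        perronKernel y (y ^ (1 / 2 : ℝ)) (((1 : ℝ) : ℂ) + v * I)‖ ≤
        C * A * (L + 1) * y ^ (-b / 2) := by
  have hJ0 : 0 ≤ ∫ v : ℝ, (1 + v ^ 2) ^ (-(1 + b / 2) / 2) :=
    integral_nonneg fun v => by positivity
  set J := ∫ v : ℝ, (1 + v ^ 2) ^ (-(1 + b / 2) / 2) with hJ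
  refine ⟨(3 + 4 / b) * (4 / b) * (J + 1), by positivity, ?_⟩
  intro D A L y hA hL hy hD hbd
  have hy0 : 0 < y := by linarith
  set h := y ^ (1 / 2 : ℝ) with hh
  have hh0 : 0 < h := by positivity
  have hD0 : DifferentiableAt ℂ D 0 := hD 0 (by simp; linarith) (by simp)
  set G : ℂ → ℂ := fun w => (((y + h : ℝ) : ℂ) ^ (w + 1) - (y : ℂ) ^ (w + 1)) / (h * (w + 1)) with hG
  set F : ℂ → ℂ := fun w => dslope D 0 w * G w with hF
  have hGd : ∀ w : ℂ, -b ≤ w.re → DifferentiableAt ℂ G w := by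
    intro w hw
    have hw1 : w + 1 ≠ 0 := ne_zero_of_re_ne_zero (by simp; linarith)
    have hhc : (h : ℂ) ≠ 0 := by exact_mod_cast hh0.ne'
    refine DifferentiableAt.div (.sub ?_ ?_) (by fun_prop) (mul_ne_zero hhc hw1)
    · exact DifferentiableAt.const_cpow (by fun_prop) (Or.inl (by exact_mod_cast (by positivity)))
    · exact DifferentiableAt.const_cpow (by fun_prop) (Or.inl (by exact_mod_cast hy0.ne'))
  have hFeq : ∀ w : ℂ, w ≠ 0 → F w = (D w - D 0) * perronKernel y h w := by
    intro w hw
    simp only [hF, hG, perronKernel, dslope_of_ne _ hw, slope_def_field, sub_zero]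
    rw [div_mul_div_comm, mul_div_assoc']
    ring_nf
  have hDD : ∀ w : ℂ, -b ≤ w.re → w.re ≤ 1 →
      ‖D w - D 0‖ ≤ A * (L + 1) * (2 + Real.log (1 + |w.im|)) := by
    intro w h1 h2
    have hl : 0 ≤ Real.log (1 + |w.im|) := Real.log_nonneg (by linarith [abs_nonneg w.im])
    have e1 := hbd w h1 h2
    have e2 := hbd 0 (by simp; linarith) (by simp)
    simp only [zero_im, abs_zero, add_zero, Real.log_one] at e2
    calc ‖D w - D 0‖ ≤ ‖D w‖ + ‖D 0‖ := norm_sub_le _ _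
      _ ≤ A * (2 * L + Real.log (1 + |w.im|)) := by linarith
      _ ≤ A * ((L + 1) * (2 + Real.log (1 + |w.im|))) := by gcongr; nlinarith
      _ = _ := by ring
  have hDD' : ∀ w : ℂ, -b ≤ w.re → w.re ≤ 1 →
      ‖D w - D 0‖ ≤ A * (L + 1) * ((3 + 4 / b) * (1 + w.im ^ 2) ^ (b / 4)) := by
    intro w h1 h2
    refine (hDD w h1 h2).trans ?_
    gcongr
    exact two_add_log_le hb _
  have hFcont : ContinuousOn F {w | w.re ∈ Icc (-b) 1} := by
    refine ContinuousOn.mul ?_ ?_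
    · intro w hw
      rcases eq_or_ne w 0 with rfl | hw0
      · exact (continuousAt_dslope_same.2 hD0).continuousWithinAt
      · exact ((continuousAt_dslope_of_ne hw0).2 (hD w hw.1 hw.2).continuousAt).continuousWithinAt
    · intro w hw
      exact (hGd w hw.1).continuousAt.continuousWithinAt
  have hline : ∀ c ∈ Icc (-b) 1, Continuous fun v : ℝ => F (c + v * I) := by
    intro c hc
    refine hFcont.comp_continuous (by fun_prop) fun v => ?_
    simpa using hc
  have hbound1 : ∀ v : ℝ, ‖F (((1 : ℝ) : ℂ) + v * I)‖ ≤
      A * (L + 1) * (3 + 4 / b) * (2 * (y + h) ^ 2 / h) * (1 + v ^ 2) ^ (-(1 + b / 2) / 2) := by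
    intro v
    set w := ((1 : ℝ) : ℂ) + v * I with hw
    have hre : w.re = 1 := by simp [hw]
    have him : w.im = v := by simp [hw]
    have hq : 0 < 1 + v ^ 2 := by positivity
    have h1 := one_add_sq_le_norm_sq one_pos le_rfl (w := w) (by simp [hre])
    have h2 := one_add_sq_le_norm_sq one_pos le_rfl (w := w + 1) (by simp [hre]; norm_num)
    simp only [add_im, one_im, add_zero, him, one_mul] at h1 h2
    rw [hFeq w (ne_zero_of_re_ne_zero (by simp [hre])), norm_mul]
    have h3 := norm_perronKernel_le_of_re_le_one hy hh0 (w := w) (by linarith)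
    have h4 := hDD' w (by linarith) (by linarith)
    rw [him] at h4
    have h5 : ‖perronKernel y h w‖ ≤ 2 * (y + h) ^ 2 / h * (1 + v ^ 2) ^ (-1 : ℝ) := by
      refine h3.trans ?_
      rw [Real.rpow_neg_one, ← div_eq_mul_inv]
      gcongr
      calc 1 + v ^ 2 = (1 + v ^ 2) ^ (1 / 2 : ℝ) * (1 + v ^ 2) ^ (1 / 2 : ℝ) := by
            rw [← Real.rpow_add hq]; norm_num
        _ ≤ _ := by gcongr
    calc _ ≤ A * (L + 1) * ((3 + 4 / b) * (1 + v ^ 2) ^ (b / 4)) *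
          (2 * (y + h) ^ 2 / h * (1 + v ^ 2) ^ (-1 : ℝ)) := by gcongr
      _ = A * (L + 1) * (3 + 4 / b) * (2 * (y + h) ^ 2 / h) * (1 + v ^ 2) ^ (b / 4 + -1) := by
          rw [Real.rpow_add hq]; ring
      _ ≤ _ := by
          gcongr
          · nlinarith [sq_nonneg v]
          · linarith
  have hboundb : ∀ v : ℝ, ‖F (((-b : ℝ) : ℂ) + v * I)‖ ≤
      A * (L + 1) * (3 + 4 / b) * (4 / b) * y ^ (-b / 2) * (1 + v ^ 2) ^ (-(1 + b / 2) / 2) := by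
    intro v
    set w := ((-b : ℝ) : ℂ) + v * I with hw
    have hre : w.re = -b := by simp [hw]
    have him : w.im = v := by simp [hw]
    have hq : 0 < 1 + v ^ 2 := by positivity
    rw [hFeq w (ne_zero_of_re_ne_zero (by rw [hre]; linarith)), norm_mul]
    have h3 := norm_perronKernel_le_of_re_eq_neg hb hb1 hy hre
    have h4 := hDD' w (by linarith) (by linarith)
    rw [him] at h3 h4
    calc _ ≤ A * (L + 1) * ((3 + 4 / b) * (1 + v ^ 2) ^ (b / 4)) *
          (4 / b * y ^ (-b / 2) * (1 + v ^ 2) ^ (-(1 + b) / 2)) := by gcongr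
      _ = A * (L + 1) * (3 + 4 / b) * (4 / b) * y ^ (-b / 2) *
          (1 + v ^ 2) ^ (b / 4 + -(1 + b) / 2) := by
          rw [Real.rpow_add hq]; ring
      _ = _ := by ring_nf
  have hint1 : Integrable fun v : ℝ => F (((1 : ℝ) : ℂ) + v * I) :=
    ((integrable_weight hb).const_mul _).mono'
      (hline 1 ⟨by linarith, le_rfl⟩).aestronglyMeasurable (ae_of_all _ hbound1)
  have hintb : Integrable fun v : ℝ => F (((-b : ℝ) : ℂ) + v * I) :=
    ((integrable_weight hb).const_mul _).mono'
      (hline (-b) ⟨le_rfl, by linarith⟩).aestronglyMeasurable (ae_of_all _ hboundb)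
  have hshift := integral_vertical_eq (f := F) (a := -b) (c := 1) (by linarith) hFcont ?_ hintb hint1
    (K := A * (L + 1) * 3 * (2 * (y + h) ^ 2 / h)) ?_
  · have e : ∀ v : ℝ, F (((1 : ℝ) : ℂ) + v * I) = (D (((1 : ℝ) : ℂ) + v * I) - D 0) *
        perronKernel y h (((1 : ℝ) : ℂ) + v * I) := fun v =>
      hFeq _ (ne_zero_of_re_ne_zero (by simp))
    simp_rw [← e]
    refine ⟨hint1, ?_⟩
    rw [← hshift]
    refine (norm_integral_le_of_norm_le ((integrable_weight hb).const_mul _)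
      (ae_of_all _ hboundb)).trans ?_
    rw [integral_const_mul, ← hJ]
    have : 0 ≤ A * (L + 1) * (3 + 4 / b) * (4 / b) * y ^ (-b / 2) := by positivity
    nlinarith
  · intro w h1 h2 h0
    exact ((differentiableAt_dslope_of_ne h0).2 (hD w h1.le h2.le)).mul (hGd w h1.le)
  · intro w h1 h2 h3
    have hv : 0 < |w.im| := by linarith
    rw [hFeq w (by rintro rfl; simp at hv), norm_mul]
    have e1 := norm_perronKernel_le_of_re_le_one hy hh0 (w := w) (by linarith)
    have e2 := hDD w h1 h2
    have e3 : Real.log (1 + |w.im|) ≤ |w.im| := by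
      have := Real.log_le_sub_one_of_pos (x := 1 + |w.im|) (by positivity)
      linarith
    have e4 : |w.im| ≤ ‖w‖ := abs_im_le_norm w
    have e5 : |w.im| ≤ ‖w + 1‖ := by simpa using abs_im_le_norm (w + 1)
    have hl : 0 ≤ Real.log (1 + |w.im|) := Real.log_nonneg (by linarith)
    calc _ ≤ A * (L + 1) * (2 + Real.log (1 + |w.im|)) * (2 * (y + h) ^ 2 / h / (‖w‖ * ‖w + 1‖)) := by
          gcongr
      _ ≤ A * (L + 1) * (3 * |w.im|) * (2 * (y + h) ^ 2 / h / (|w.im| * |w.im|)) := by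
          gcongr
          linarith
      _ = _ := by field_simp

lemma log_conductor_add_le {N : ℕ} [NeZero N] (t v : ℝ) :
    Real.log (conductor N (t + v)) ≤ Real.log (conductor N t) + Real.log (1 + |v|) := by
  have h1 := two_le_conductor N t
  have h2 := two_le_conductor N (t + v)
  rw [← Real.log_mul (by linarith) (by positivity)]
  refine Real.log_le_log (by linarith) ?_
  unfold conductor
  rw [mul_assoc]
  gcongr
  nlinarith [abs_add_le t v, abs_nonneg t, abs_nonneg v]

/-- The coefficients `χ(n) Λ(n) n ^ (-s)`. -/
def twistedVonMangoldt {N : ℕ} (χ : DirichletCharacter ℂ N) (s : ℂ) (n : ℕ) : ℂ :=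
  χ n * ArithmeticFunction.vonMangoldt n * (n : ℂ) ^ (-s)

lemma term_twistedVonMangoldt {N : ℕ} (χ : DirichletCharacter ℂ N) (s w : ℂ) :
    LSeries.term (twistedVonMangoldt χ s) w =
      LSeries.term ((fun n : ℕ => χ n) * fun n : ℕ => (ArithmeticFunction.vonMangoldt n : ℂ)) (s + w) := by
  ext n
  rcases eq_or_ne n 0 with rfl | hn
  · simp
  · have : (n : ℂ) ≠ 0 := by exact_mod_cast hn
    rw [LSeries.term_of_ne_zero hn, LSeries.term_of_ne_zero hn, twistedVonMangoldt, Pi.mul_apply,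
      cpow_add _ _ this, cpow_neg]
    field_simp

lemma norm_twistedVonMangoldt_le {N : ℕ} (χ : DirichletCharacter ℂ N) (s : ℂ) {n : ℕ}
    (hn : n ≠ 0) : ‖twistedVonMangoldt χ s n‖ ≤ Real.log n * (n : ℝ) ^ (-s.re) := by
  rw [twistedVonMangoldt, norm_mul, norm_mul, norm_natCast_cpow_of_pos (by omega), norm_real,
    Real.norm_of_nonneg ArithmeticFunction.vonMangoldt_nonneg, neg_re]
  gcongr
  calc _ ≤ 1 * ArithmeticFunction.vonMangoldt n := by
        gcongr
        exact χ.norm_le_one _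
    _ ≤ _ := by rw [one_mul]; exact ArithmeticFunction.vonMangoldt_le_log

lemma norm_tsum_cutoff_sub_logDeriv_le
    (hG : ∀ (N : ℕ) [NeZero N] (χ : DirichletCharacter ℂ N) (s : ℂ),
      0 < s.re → s.re < 1 → DirichletCharacter.LFunction χ s = 0 → s.re = 1 / 2)
    {η : ℝ} (hη : 0 < η) (hη1 : η < 1 / 2) :
    ∃ C > 0, ∀ (N : ℕ) [NeZero N] (χ : DirichletCharacter ℂ N), χ ≠ 1 → ∀ s : ℂ,
      s.re = 1 / 2 + η → ∀ y : ℝ, 1 ≤ y →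
      ‖∑' n : ℕ, (if n = 0 then 0 else twistedVonMangoldt χ s n * (cutoff y (y ^ (1 / 2 : ℝ)) n : ℂ)) -
        (-(deriv χ.LFunction s / χ.LFunction s))‖ ≤
      C * (Real.log (conductor N s.im) + 1) * y ^ (-η / 4) := by
  obtain ⟨A, hA, hAb⟩ := norm_logDeriv_LFunction_le hG (half_pos hη) (by linarith : η / 2 < 1 / 2)
  obtain ⟨B, hB, hBb⟩ := norm_integral_perron_shift_le (half_pos hη) (by linarith : η / 2 ≤ 1 / 2)
  refine ⟨B * A / (2 * Real.pi), by positivity, ?_⟩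
  intro N _ χ hχ s hs y hy
  set D : ℂ → ℂ := fun w => -(deriv χ.LFunction (s + w) / χ.LFunction (s + w)) with hD
  have hL0 : 0 ≤ Real.log (conductor N s.im) :=
    Real.log_nonneg (by linarith [two_le_conductor N s.im])
  have hdiff := DirichletCharacter.differentiable_LFunction hχ
  have hy0 : 0 < y := by linarith
  have hh0 : 0 < y ^ (1 / 2 : ℝ) := by positivity
  have hd : ∀ w : ℂ, -(η / 2) ≤ w.re → w.re ≤ 1 → DifferentiableAt ℂ D w := by
    intro w hw1 hw2
    have hre : 1 / 2 < (s + w).re := by rw [add_re, hs]; linarith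
    have hne := LFunction_ne_zero_of_GRH hG hχ hre
    have ha : AnalyticAt ℂ χ.LFunction (s + w) := hdiff.analyticAt _
    have := (ha.deriv.differentiableAt.div ha.differentiableAt hne).neg
    have h4 : DifferentiableAt ℂ (fun w => s + w) w := by fun_prop
    exact DifferentiableAt.comp (g := -(deriv χ.LFunction / χ.LFunction)) w this h4
  have hDb : ∀ w : ℂ, -(η / 2) ≤ w.re → w.re ≤ 1 →
      ‖D w‖ ≤ A * (Real.log (conductor N s.im) + Real.log (1 + |w.im|)) := by
    intro w hw1 hw2
    rw [hD, norm_neg]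
    refine (hAb N χ hχ (s + w) (by rw [add_re, hs]; linarith)
      (by rw [add_re, hs]; linarith)).trans ?_
    gcongr
    rw [add_im]
    exact log_conductor_add_le _ _
  obtain ⟨h1, h2⟩ := hBb D A (Real.log (conductor N s.im)) y hA hL0 hy hd hDb
  have hsum : LSeriesSummable (twistedVonMangoldt χ s) 1 := by
    have := DirichletCharacter.LSeriesSummable_twist_vonMangoldt χ (s := s + 1)
      (by simp only [add_re, hs, one_re]; linarith)
    unfold LSeriesSummable at this ⊢
    rwa [term_twistedVonMangoldt]
  have hP := integral_LSeries_mul_perronKernel hy0 hh0 hsum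
  have hDL : ∀ v : ℝ, LSeries (twistedVonMangoldt χ s) (((1 : ℝ) : ℂ) + v * I) =
      D (((1 : ℝ) : ℂ) + v * I) := by
    intro v
    have hre : 1 < (s + (((1 : ℝ) : ℂ) + v * I)).re := by
      simp [hs]; linarith
    have hev : (χ.LFunction) =ᶠ[𝓝 (s + (((1 : ℝ) : ℂ) + v * I))] LSeries (fun n : ℕ => χ n) := by
      filter_upwards [(isOpen_lt continuous_const continuous_re).mem_nhds hre] with z hz
      exact DirichletCharacter.LFunction_eq_LSeries χ hz
    rw [LSeries, term_twistedVonMangoldt, ← LSeries,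
      DirichletCharacter.LSeries_twist_vonMangoldt_eq χ hre, hD]
    simp only
    rw [hev.deriv_eq, hev.eq_of_nhds, neg_div]
  have hone : ∫ v : ℝ, perronKernel y (y ^ (1 / 2 : ℝ)) (((1 : ℝ) : ℂ) + v * I) = 2 * Real.pi := by
    have := integral_perronKernel (n := 1) hy0 hh0 one_pos
    rw [cutoff_of_le hh0 hy] at this
    simpa using this
  have hK := integrable_perronKernel hy0 hh0
  have hInt : ∫ v : ℝ, (D (((1 : ℝ) : ℂ) + v * I) - D 0) *
      perronKernel y (y ^ (1 / 2 : ℝ)) (((1 : ℝ) : ℂ) + v * I) =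
      2 * Real.pi * (∑' n : ℕ, (if n = 0 then 0 else
        twistedVonMangoldt χ s n * (cutoff y (y ^ (1 / 2 : ℝ)) n : ℂ)) - D 0) := by
    rw [mul_sub, ← hP, ← hone, mul_comm _ (D 0), ← integral_const_mul, ← integral_sub]
    · congr 1
      ext v
      rw [hDL]
      ring
    · refine (h1.add (hK.const_mul (D 0))).congr (ae_of_all _ fun v => ?_)
      simp only [Pi.add_apply, hDL]
      ring
    · exact hK.const_mul _
  have h0 : D 0 = -(deriv χ.LFunction s / χ.LFunction s) := by simp [hD]
  rw [hInt, h0, norm_mul] at h2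
  have h3 : ‖(2 * Real.pi : ℂ)‖ = 2 * Real.pi := by
    rw [← ofReal_ofNat, ← ofReal_mul, norm_real, Real.norm_of_nonneg (by positivity)]
  rw [h3, ← le_div_iff₀' (by positivity)] at h2
  refine h2.trans (le_of_eq ?_)
  rw [show -(η / 2) / 2 = -η / 4 by ring]
  ring

lemma exists_norm_cutoff_error_le {η : ℝ} (hη : 0 < η) : ∃ C > 0,
    ∀ (N : ℕ) (χ : DirichletCharacter ℂ N) (s : ℂ), s.re = 1 / 2 + η → ∀ M : ℕ, 1 ≤ M →
      ‖∑' n : ℕ, (if n = 0 then 0 else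
          twistedVonMangoldt χ s n * (cutoff M ((M : ℝ) ^ (1 / 2 : ℝ)) n : ℂ)) -
        ∑ n ∈ Finset.Icc 1 M, twistedVonMangoldt χ s n‖ ≤ C := by
  refine ⟨2 * (1 / η + 1), by positivity, ?_⟩
  intro N χ s hs M hM
  have hM1 : (1 : ℝ) ≤ M := by exact_mod_cast hM
  have hM0 : (0 : ℝ) < M := by linarith
  set h := (M : ℝ) ^ (1 / 2 : ℝ) with hh
  have hh0 : 0 < h := by positivity
  have hhM : h ≤ M := by
    calc h ≤ (M : ℝ) ^ (1 : ℝ) := Real.rpow_le_rpow_of_exponent_le hM1 (by norm_num)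
      _ = M := Real.rpow_one _
  have hfl : M ≤ M + ⌊h⌋₊ := by omega
  have hsum : ∑' n : ℕ, (if n = 0 then 0 else twistedVonMangoldt χ s n * (cutoff M h n : ℂ)) =
      ∑ n ∈ Finset.Icc 1 (M + ⌊h⌋₊), twistedVonMangoldt χ s n * (cutoff M h n : ℂ) := by
    rw [tsum_eq_sum (s := Finset.Icc 1 (M + ⌊h⌋₊))]
    · refine Finset.sum_congr rfl fun n hn => ?_
      rw [if_neg (by have := (Finset.mem_Icc.1 hn).1; omega)]
    · intro n hn
      split_ifs with h0
      · rfl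
      · have h1 : M + ⌊h⌋₊ + 1 ≤ n := by
          by_contra hc
          exact hn (Finset.mem_Icc.2 ⟨by omega, by omega⟩)
        have h2 : (M : ℝ) + ⌊h⌋₊ + 1 ≤ n := by exact_mod_cast h1
        rw [cutoff_of_ge hh0 (by linarith [Nat.lt_floor_add_one h])]
        simp
  have hsplit : Finset.Icc 1 (M + ⌊h⌋₊) = Finset.Icc 1 M ∪ Finset.Ioc M (M + ⌊h⌋₊) := by
    ext n; simp only [Finset.mem_Icc, Finset.mem_union, Finset.mem_Ioc]; omega
  have hdisj : Disjoint (Finset.Icc 1 M) (Finset.Ioc M (M + ⌊h⌋₊)) := by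
    rw [Finset.disjoint_left]
    intro n h1 h2
    rw [Finset.mem_Icc] at h1; rw [Finset.mem_Ioc] at h2; omega
  have hmain : ∑ n ∈ Finset.Icc 1 M, twistedVonMangoldt χ s n * (cutoff M h n : ℂ) =
      ∑ n ∈ Finset.Icc 1 M, twistedVonMangoldt χ s n := by
    refine Finset.sum_congr rfl fun n hn => ?_
    have : (n : ℝ) ≤ M := by exact_mod_cast (Finset.mem_Icc.1 hn).2
    rw [cutoff_of_le hh0 this]; simp
  rw [hsum, hsplit, Finset.sum_union hdisj, hmain, add_sub_cancel_left]
  have hlog : Real.log (2 * M) ≤ (1 / η + 1) * (M : ℝ) ^ η := by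
    have h1 := Real.log_le_rpow_div hM0.le hη
    have h2 := Real.one_le_rpow hM1 hη.le
    rw [Real.log_mul (by norm_num) hM0.ne']
    have : (M : ℝ) ^ η / η = 1 / η * (M : ℝ) ^ η := by ring
    linarith [Real.log_two_lt_d9]
  calc _ ≤ ∑ n ∈ Finset.Ioc M (M + ⌊h⌋₊), Real.log (2 * M) * (M : ℝ) ^ (-(1 / 2 + η)) := by
        refine norm_sum_le_of_le _ fun n hn => ?_
        obtain ⟨hn1, hn2⟩ := Finset.mem_Ioc.1 hn
        have e1 : (M : ℝ) ≤ n := by exact_mod_cast hn1.le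
        have e2 : (n : ℝ) ≤ M + ⌊h⌋₊ := by exact_mod_cast hn2
        have e3 := Nat.floor_le hh0.le
        rw [norm_mul, norm_real, Real.norm_of_nonneg (cutoff_nonneg hh0)]
        calc _ ≤ Real.log n * (n : ℝ) ^ (-s.re) * 1 := by
              gcongr
              · exact cutoff_nonneg hh0
              · exact norm_twistedVonMangoldt_le χ s (by omega)
              · exact cutoff_le_one hh0
          _ ≤ Real.log (2 * M) * (M : ℝ) ^ (-(1 / 2 + η)) := by
              rw [mul_one, hs]
              refine mul_le_mul (Real.log_le_log (by linarith) (by linarith))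
                (Real.rpow_le_rpow_of_nonpos hM0 e1 (by linarith)) (by positivity)
                (Real.log_nonneg (by linarith))
    _ = ⌊h⌋₊ * (Real.log (2 * M) * (M : ℝ) ^ (-(1 / 2 + η))) := by simp
    _ ≤ h * ((1 / η + 1) * (M : ℝ) ^ η * (M : ℝ) ^ (-(1 / 2 + η))) := by
        have := Real.log_nonneg (by linarith : (1:ℝ) ≤ 2 * M)
        gcongr
        exact Nat.floor_le hh0.le
    _ = (1 / η + 1) * ((M : ℝ) ^ (1 / 2 : ℝ) * (M : ℝ) ^ η * (M : ℝ) ^ (-(1 / 2 + η))) := by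
        rw [hh]; ring
    _ = (1 / η + 1) := by
        rw [← Real.rpow_add hM0, ← Real.rpow_add hM0]
        norm_num
    _ ≤ _ := by linarith [show 0 < 1 / η by positivity]

lemma exists_norm_sum_twistedVonMangoldt_le
    (hG : ∀ (N : ℕ) [NeZero N] (χ : DirichletCharacter ℂ N) (s : ℂ),
      0 < s.re → s.re < 1 → DirichletCharacter.LFunction χ s = 0 → s.re = 1 / 2)
    {η : ℝ} (hη : 0 < η) (hη1 : η < 1 / 2) {δ : ℝ} (hδ : 0 < δ) :
    ∃ C > 0, ∀ (N : ℕ) [NeZero N] (χ : DirichletCharacter ℂ N), χ ≠ 1 → ∀ s : ℂ,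
      s.re = 1 / 2 + η → ∀ M : ℕ,
      ‖∑ n ∈ Finset.Icc 1 M, twistedVonMangoldt χ s n‖ ≤ δ * Real.log (conductor N s.im) + C := by
  obtain ⟨C₁, hC₁, h₁⟩ := norm_tsum_cutoff_sub_logDeriv_le hG hη hη1
  obtain ⟨C₂, hC₂, h₂⟩ := exists_norm_cutoff_error_le hη
  obtain ⟨M₀, hM₀⟩ : ∃ M₀ : ℕ, 1 ≤ M₀ ∧ C₁ * (M₀ : ℝ) ^ (-η / 4) ≤ δ / 2 := by
    have ht : Tendsto (fun M : ℕ => C₁ * (M : ℝ) ^ (-η / 4)) atTop (𝓝 0) := by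
      have := (tendsto_rpow_neg_atTop (by positivity : 0 < η / 4)).comp
        tendsto_natCast_atTop_atTop |>.const_mul C₁
      simpa [neg_div, Function.comp_def] using this
    exact ((eventually_ge_atTop 1).and (ht.eventually_le_const (by positivity))).exists
  obtain ⟨hM1, hM2⟩ := hM₀
  set K := ∑ n ∈ Finset.Icc 1 M₀, Real.log n with hK
  have hK0 : 0 ≤ K := Finset.sum_nonneg fun n hn =>
    Real.log_nonneg (by exact_mod_cast (Finset.mem_Icc.1 hn).1)
  refine ⟨K + 2 * C₂ + δ, by positivity, ?_⟩
  intro N _ χ hχ s hs M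
  have hL0 : 0 ≤ Real.log (conductor N s.im) :=
    Real.log_nonneg (by linarith [two_le_conductor N s.im])
  set D := -(deriv χ.LFunction s / χ.LFunction s) with hD
  have hsmall : ∀ M : ℕ, M ≤ M₀ → ‖∑ n ∈ Finset.Icc 1 M, twistedVonMangoldt χ s n‖ ≤ K := by
    intro M hM
    refine (norm_sum_le_of_le (f := fun n => twistedVonMangoldt χ s n) (n := fun n => Real.log n)
      _ fun n hn => ?_).trans
      (Finset.sum_le_sum_of_subset_of_nonneg (Finset.Icc_subset_Icc_right hM) fun n hn _ =>
        Real.log_nonneg (by exact_mod_cast (Finset.mem_Icc.1 hn).1))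
    have hn1 := (Finset.mem_Icc.1 hn).1
    have hn2 : (1 : ℝ) ≤ n := by exact_mod_cast hn1
    refine (norm_twistedVonMangoldt_le χ s (by omega)).trans ?_
    refine mul_le_of_le_one_right (Real.log_nonneg hn2)
      (Real.rpow_le_one_of_one_le_of_nonpos hn2 (by rw [hs]; linarith))
  have hlarge : ∀ M : ℕ, M₀ ≤ M → ‖∑ n ∈ Finset.Icc 1 M, twistedVonMangoldt χ s n - D‖ ≤
      δ / 2 * (Real.log (conductor N s.im) + 1) + C₂ := by
    intro M hM
    have hM3 : (1 : ℝ) ≤ M := by exact_mod_cast hM1.trans hM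
    have e1 := h₁ N χ hχ s hs M hM3
    have e2 := h₂ N χ s hs M (hM1.trans hM)
    rw [norm_sub_rev] at e2
    have e3 : C₁ * (M : ℝ) ^ (-η / 4) ≤ δ / 2 := by
      refine le_trans ?_ hM2
      gcongr ?_ * ?_
      exact Real.rpow_le_rpow_of_nonpos (by exact_mod_cast hM1) (by exact_mod_cast hM)
        (by linarith)
    have e4 : C₁ * (Real.log (conductor N s.im) + 1) * (M : ℝ) ^ (-η / 4) ≤
        δ / 2 * (Real.log (conductor N s.im) + 1) := by nlinarith
    have := norm_sub_le_norm_sub_add_norm_sub (∑ n ∈ Finset.Icc 1 M, twistedVonMangoldt χ s n)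
      (∑' n : ℕ, (if n = 0 then 0 else
          twistedVonMangoldt χ s n * (cutoff M ((M : ℝ) ^ (1 / 2 : ℝ)) n : ℂ))) D
    linarith
  rcases le_total M M₀ with hM | hM
  · have := hsmall M hM
    nlinarith
  · have e1 := hlarge M hM
    have e2 := hlarge M₀ le_rfl
    have e3 := hsmall M₀ le_rfl
    have e4 : ‖∑ n ∈ Finset.Icc 1 M, twistedVonMangoldt χ s n‖ ≤
        ‖∑ n ∈ Finset.Icc 1 M, twistedVonMangoldt χ s n - D‖ +
        ‖∑ n ∈ Finset.Icc 1 M₀, twistedVonMangoldt χ s n - D‖ +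
        ‖∑ n ∈ Finset.Icc 1 M₀, twistedVonMangoldt χ s n‖ := by
      refine le_trans (le_of_eq ?_) ((norm_add_le _ _).trans (add_le_add_left (norm_sub_le _ _) _))
      congr 1; ring
    linarith

lemma sum_Icc_mul_eq_sum_sub_mul {R : Type*} [CommRing R] (f z : ℕ → R) (M : ℕ) :
    ∑ n ∈ Finset.Icc 1 M, f n * z n = f (M + 1) * ∑ n ∈ Finset.Icc 1 M, z n +
      ∑ n ∈ Finset.Icc 1 M, (f n - f (n + 1)) * ∑ k ∈ Finset.Icc 1 n, z k := by
  induction M with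
  | zero => simp
  | succ M ih =>
    rw [Finset.sum_Icc_succ_top (by omega), ih, Finset.sum_Icc_succ_top (by omega),
      Finset.sum_Icc_succ_top (by omega)
        (f := fun n => (f n - f (n + 1)) * ∑ k ∈ Finset.Icc 1 n, z k),
      Finset.sum_Icc_succ_top (by omega)]
    ring

lemma sum_Icc_mul_le_of_antitone {f z z' : ℕ → ℝ} (hf : ∀ n, 1 ≤ n → 0 ≤ f n)
    (hf' : ∀ n, 1 ≤ n → f (n + 1) ≤ f n)
    (h : ∀ n, ∑ k ∈ Finset.Icc 1 n, z k ≤ ∑ k ∈ Finset.Icc 1 n, z' k) (M : ℕ) :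
    ∑ n ∈ Finset.Icc 1 M, f n * z n ≤ ∑ n ∈ Finset.Icc 1 M, f n * z' n := by
  rw [sum_Icc_mul_eq_sum_sub_mul f z, sum_Icc_mul_eq_sum_sub_mul f z']
  refine add_le_add (mul_le_mul_of_nonneg_left (h M) (hf _ (Nat.le_add_left 1 M)))
    (Finset.sum_le_sum fun n hn => mul_le_mul_of_nonneg_left (h n) ?_)
  linarith [hf' n (Finset.mem_Icc.1 hn).1]

lemma norm_sum_Icc_mul_le_of_antitone {f : ℕ → ℝ} {z : ℕ → ℂ} {B : ℝ}
    (hf : ∀ n, 1 ≤ n → 0 ≤ f n) (hf' : ∀ n, 1 ≤ n → f (n + 1) ≤ f n)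
    (h : ∀ n, ‖∑ k ∈ Finset.Icc 1 n, z k‖ ≤ B) (M : ℕ) :
    ‖∑ n ∈ Finset.Icc 1 M, (f n : ℂ) * z n‖ ≤ f 1 * B := by
  have hd : ∀ n, 1 ≤ n → ‖((f n : ℂ) - f (n + 1))‖ = f n - f (n + 1) := by
    intro n hn
    rw [← ofReal_sub, norm_real, Real.norm_of_nonneg (by linarith [hf' n hn])]
  have hn1 : ‖(f (M + 1) : ℂ)‖ = f (M + 1) := by
    rw [norm_real, Real.norm_of_nonneg (hf _ (by omega))]
  have htel : f (M + 1) + ∑ n ∈ Finset.Icc 1 M, (f n - f (n + 1)) = f 1 := by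
    induction M with
    | zero => simp
    | succ M ih =>
      rw [Finset.sum_Icc_succ_top (by omega)]
      have := ih (by rw [norm_real, Real.norm_of_nonneg (hf _ (by omega))])
      linarith
  rw [sum_Icc_mul_eq_sum_sub_mul (fun n => (f n : ℂ))]
  calc _ ≤ f (M + 1) * B + ∑ n ∈ Finset.Icc 1 M, (f n - f (n + 1)) * B := by
        refine (norm_add_le _ _).trans (add_le_add ?_ (norm_sum_le_of_le _ fun n hn => ?_))
        · rw [norm_mul, hn1]
          exact mul_le_mul_of_nonneg_left (h M) (hf _ (by omega))
        · have h1 := (Finset.mem_Icc.1 hn).1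
          rw [norm_mul, hd n h1]
          exact mul_le_mul_of_nonneg_left (h n) (by linarith [hf' n h1])
    _ = f 1 * B := by rw [← Finset.sum_mul, ← add_mul, htel]

lemma sqrt_sub_sqrt_le {n : ℕ} (hn : 1 ≤ n) :
    √(n : ℝ) - √((n - 1 : ℕ) : ℝ) ≤ (n : ℝ) ^ (-(1 / 2) : ℝ) := by
  have hn0 : (0 : ℝ) < n := by exact_mod_cast hn
  have h1 : 0 < √(n : ℝ) := Real.sqrt_pos.2 hn0
  have h2 : √(n : ℝ) ^ 2 = n := Real.sq_sqrt hn0.le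
  have h3 : √((n - 1 : ℕ) : ℝ) ^ 2 = n - 1 := by
    rw [Real.sq_sqrt (by positivity), Nat.cast_sub hn]; simp
  have h4 : 0 ≤ √((n - 1 : ℕ) : ℝ) := Real.sqrt_nonneg _
  rw [Real.rpow_neg hn0.le, ← Real.sqrt_eq_rpow, ← one_div, le_div_iff₀ h1]
  have h5 : √((n - 1 : ℕ) : ℝ) ≤ √(n : ℝ) := by
    apply Real.sqrt_le_sqrt; exact_mod_cast Nat.sub_le n 1
  nlinarith

lemma sum_sqrt_sub_sqrt (M : ℕ) :
    ∑ n ∈ Finset.Icc 1 M, (√(n : ℝ) - √((n - 1 : ℕ) : ℝ)) = √(M : ℝ) := by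
  induction M with
  | zero => simp
  | succ M ih => rw [Finset.sum_Icc_succ_top (by omega), ih]; simp

lemma exists_sum_not_prime_le {η : ℝ} (hη : 0 < η) : ∃ C > 0, ∀ M : ℕ,
    ∑ n ∈ Finset.Icc 1 M, (n : ℝ) ^ (-(1 / 2 + η)) *
      (if n.Prime then 0 else ArithmeticFunction.vonMangoldt n) ≤ C := by
  obtain ⟨C, hC⟩ := Chebyshev.psi_sub_theta_le_mul_sqrt
  have hsm : Summable fun n : ℕ => (n : ℝ) ^ (-(1 + η)) :=
    Real.summable_nat_rpow.2 (by linarith)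
  refine ⟨max C 0 * ∑' n : ℕ, (n : ℝ) ^ (-(1 + η)) + 1, by positivity, fun M => ?_⟩
  refine (sum_Icc_mul_le_of_antitone (z' := fun n => max C 0 * (√(n : ℝ) - √((n - 1 : ℕ) : ℝ)))
    (fun n _ => by positivity) (fun n hn => ?_) (fun n => ?_) M).trans ?_
  · exact Real.rpow_le_rpow_of_nonpos (by exact_mod_cast hn) (by simp) (by linarith)
  · rw [← Finset.mul_sum, sum_sqrt_sub_sqrt]
    have h1 := hC n
    rw [Chebyshev.psi_sub_theta_eq_sum_not_prime, Nat.floor_natCast, Finset.sum_filter] at h1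
    have h2 : Finset.Icc 1 n = Finset.Ioc 0 n := rfl
    rw [h2]
    have h3 : C * √(n : ℝ) ≤ max C 0 * √(n : ℝ) := by gcongr; exact le_max_left _ _
    refine le_trans (le_of_eq ?_) (h1.trans h3)
    refine Finset.sum_congr rfl fun k _ => ?_
    by_cases hk : k.Prime <;> simp [hk]
  · calc _ ≤ ∑ n ∈ Finset.Icc 1 M, max C 0 * (n : ℝ) ^ (-(1 + η)) := by
          refine Finset.sum_le_sum fun n hn => ?_
          have hn1 := (Finset.mem_Icc.1 hn).1
          have hn0 : (0 : ℝ) < n := by exact_mod_cast hn1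
          rw [show -(1 + η) = -(1 / 2 + η) + (-(1 / 2)) by ring, Real.rpow_add hn0, mul_left_comm]
          gcongr
          exact sqrt_sub_sqrt_le hn1
      _ ≤ max C 0 * ∑' n : ℕ, (n : ℝ) ^ (-(1 + η)) := by
          rw [← Finset.mul_sum]
          gcongr
          exact hsm.sum_le_tsum _ fun n _ => by positivity
      _ ≤ _ := by linarith

lemma exists_norm_sum_prime_le
    (hG : ∀ (N : ℕ) [NeZero N] (χ : DirichletCharacter ℂ N) (s : ℂ),
      0 < s.re → s.re < 1 → DirichletCharacter.LFunction χ s = 0 → s.re = 1 / 2)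
    {η : ℝ} (hη : 0 < η) (hη1 : η < 1 / 2) {δ : ℝ} (hδ : 0 < δ) :
    ∃ C > 0, ∀ (N : ℕ) [NeZero N] (χ : DirichletCharacter ℂ N), χ ≠ 1 → ∀ s : ℂ,
      s.re = 1 / 2 + η → ∀ M : ℕ,
      ‖∑ p ∈ (M + 1).primesBelow, χ p * (p : ℂ) ^ (-s)‖ ≤
        δ * Real.log (conductor N s.im) + C := by
  obtain ⟨C₁, hC₁, h₁⟩ := exists_norm_sum_twistedVonMangoldt_le hG hη hη1 (half_pos hδ)
  obtain ⟨C₂, hC₂, h₂⟩ := exists_sum_not_prime_le hη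
  refine ⟨2 * (C₁ + C₂), by positivity, ?_⟩
  intro N _ χ hχ s hs M
  set f : ℕ → ℝ := fun n => (Real.log (max n 2 : ℕ))⁻¹ with hf
  set z : ℕ → ℂ := fun n => if n.Prime then twistedVonMangoldt χ s n else 0 with hz
  have hlogpos : ∀ n : ℕ, 0 < Real.log (max n 2 : ℕ) := fun n =>
    Real.log_pos (by exact_mod_cast (by omega : 1 < max n 2))
  have hpart : ∀ n, ‖∑ k ∈ Finset.Icc 1 n, z k‖ ≤
      δ / 2 * Real.log (conductor N s.im) + (C₁ + C₂) := by
    intro n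
    have e1 := h₁ N χ hχ s hs n
    have e2 : ‖∑ k ∈ Finset.Icc 1 n, (twistedVonMangoldt χ s k - z k)‖ ≤ C₂ := by
      refine (norm_sum_le_of_le _ fun k hk => ?_).trans (h₂ n)
      have hk1 := (Finset.mem_Icc.1 hk).1
      by_cases hp : k.Prime
      · simp [hz, hp]
      · simp only [hz, hp, if_false, sub_zero]
        rw [twistedVonMangoldt, norm_mul, norm_mul, norm_natCast_cpow_of_pos (by omega), norm_real,
          Real.norm_of_nonneg ArithmeticFunction.vonMangoldt_nonneg, neg_re, hs, mul_comm]
        gcongr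
        exact mul_le_of_le_one_left ArithmeticFunction.vonMangoldt_nonneg (χ.norm_le_one _)
    have e3 : ∑ k ∈ Finset.Icc 1 n, z k = ∑ k ∈ Finset.Icc 1 n, twistedVonMangoldt χ s k -
        ∑ k ∈ Finset.Icc 1 n, (twistedVonMangoldt χ s k - z k) := by
      rw [Finset.sum_sub_distrib]; ring
    rw [e3]
    refine (norm_sub_le _ _).trans ?_
    linarith
  have hmain := norm_sum_Icc_mul_le_of_antitone (f := f) (z := z)
    (fun n _ => inv_nonneg.2 (hlogpos n).le) (fun n _ => ?_) hpart M
  · have e1 : ∑ n ∈ Finset.Icc 1 M, (f n : ℂ) * z n =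
        ∑ p ∈ (M + 1).primesBelow, χ p * (p : ℂ) ^ (-s) := by
      have hP : (M + 1).primesBelow = (Finset.Icc 1 M).filter Nat.Prime := by
        ext p
        simp only [Nat.mem_primesBelow, Finset.mem_filter, Finset.mem_Icc]
        exact ⟨fun h => ⟨⟨h.2.one_lt.le, by omega⟩, h.2⟩, fun h => ⟨by omega, h.2⟩⟩
      rw [hP, Finset.sum_filter]
      refine Finset.sum_congr rfl fun n hn => ?_
      by_cases hp : n.Prime
      · simp only [hz, hf, hp, if_true, twistedVonMangoldt,
          ArithmeticFunction.vonMangoldt_apply_prime hp, max_eq_left hp.two_le]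
        have : (Real.log n : ℂ) ≠ 0 := by
          have := hlogpos n
          rw [max_eq_left hp.two_le] at this
          exact_mod_cast this.ne'
        rw [ofReal_inv]
        field_simp
      · simp [hz, hp]
    rw [e1] at hmain
    have e2 : f 1 ≤ 2 := by
      simp only [hf]
      norm_num
      rw [inv_le_comm₀ (Real.log_pos (by norm_num)) (by norm_num)]
      linarith [Real.log_two_gt_d9]
    have e3 : 0 ≤ δ / 2 * Real.log (conductor N s.im) + (C₁ + C₂) := (norm_nonneg _).trans (hpart 0)
    nlinarith
  · simp only [hf]
    gcongr
    · exact hlogpos n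
    · exact Nat.le_succ n

lemma norm_inv_one_sub_le {z : ℂ} (hz : ‖z‖ ≤ 18 / 25) :
    ‖(1 - z)⁻¹‖ ≤ Real.exp (z.re + 2 * ‖z‖ ^ 2) := by
  have h1 := norm_log_one_add_sub_self_le (z := -z) (by rw [norm_neg]; linarith)
  rw [norm_neg, sub_neg_eq_add, ← sub_eq_add_neg] at h1
  have hne : 1 - z ≠ 0 := by
    intro h
    have : z = 1 := (sub_eq_zero.1 h).symm
    rw [this] at hz; norm_num at hz
  have h2 : ‖z‖ ^ 2 * (1 - ‖z‖)⁻¹ / 2 ≤ 2 * ‖z‖ ^ 2 := by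
    have : (1 - ‖z‖)⁻¹ ≤ 4 := by
      rw [inv_le_comm₀ (by linarith) (by norm_num)]; linarith
    nlinarith [sq_nonneg ‖z‖]
  have h3 := (abs_re_le_norm (log (1 - z) + z)).trans (h1.trans h2)
  rw [add_re] at h3
  rw [norm_inv, ← Complex.exp_log hne, norm_exp, ← Real.exp_neg, Real.exp_le_exp]
  linarith [(abs_le.1 h3).1]

/-- Under GRH, a truncated Euler product of `L(s, χ)` to the right of the critical line is bounded
by an arbitrarily small power of the conductor. -/
lemma exists_norm_prod_primesBelow_le
    (hG : ∀ (N : ℕ) [NeZero N] (χ : DirichletCharacter ℂ N) (s : ℂ),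
      0 < s.re → s.re < 1 → DirichletCharacter.LFunction χ s = 0 → s.re = 1 / 2)
    {η : ℝ} (hη : 0 < η) (hη1 : η < 1 / 2) {δ : ℝ} (hδ : 0 < δ) :
    ∃ C > 0, ∀ (N : ℕ) [NeZero N] (χ : DirichletCharacter ℂ N), χ ≠ 1 → ∀ s : ℂ,
      s.re = 1 / 2 + η → ∀ M : ℕ,
      ‖∏ p ∈ (M + 1).primesBelow, (1 - χ p * (p : ℂ) ^ (-s))⁻¹‖ ≤ C * conductor N s.im ^ δ := by
  obtain ⟨C, hC, h⟩ := exists_norm_sum_prime_le hG hη hη1 hδ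
  have hsm : Summable fun n : ℕ => (n : ℝ) ^ (-(1 + 2 * η)) :=
    Real.summable_nat_rpow.2 (by linarith)
  refine ⟨Real.exp (C + 2 * ∑' n : ℕ, (n : ℝ) ^ (-(1 + 2 * η))), Real.exp_pos _, ?_⟩
  intro N _ χ hχ s hs M
  have hz : ∀ p : ℕ, p.Prime → ‖χ p * (p : ℂ) ^ (-s)‖ ≤ (p : ℝ) ^ (-(1 / 2 + η)) := by
    intro p hp
    rw [norm_mul, norm_natCast_cpow_of_pos hp.pos, neg_re, hs]
    exact mul_le_of_le_one_left (by positivity) (χ.norm_le_one _)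
  have hz2 : ∀ p : ℕ, p.Prime → ‖χ p * (p : ℂ) ^ (-s)‖ ≤ 18 / 25 := by
    intro p hp
    refine (hz p hp).trans ?_
    have h2 : (2 : ℝ) ≤ p := by exact_mod_cast hp.two_le
    calc (p : ℝ) ^ (-(1 / 2 + η)) ≤ (p : ℝ) ^ (-(1 / 2) : ℝ) :=
          Real.rpow_le_rpow_of_exponent_le (by linarith) (by linarith)
      _ ≤ (2 : ℝ) ^ (-(1 / 2) : ℝ) := Real.rpow_le_rpow_of_nonpos (by norm_num) h2 (by norm_num)
      _ ≤ _ := by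
          rw [Real.rpow_neg (by norm_num), ← Real.sqrt_eq_rpow,
            inv_le_comm₀ (by positivity) (by norm_num)]
          apply Real.le_sqrt_of_sq_le
          norm_num
  have hcond : 0 < conductor N s.im := by linarith [two_le_conductor N s.im]
  rw [norm_prod]
  calc _ ≤ ∏ p ∈ (M + 1).primesBelow,
        Real.exp ((χ p * (p : ℂ) ^ (-s)).re + 2 * ‖χ p * (p : ℂ) ^ (-s)‖ ^ 2) :=
        Finset.prod_le_prod (fun _ _ => norm_nonneg _) fun p hp =>
          norm_inv_one_sub_le (hz2 p (Nat.mem_primesBelow.1 hp).2)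
    _ = Real.exp ((∑ p ∈ (M + 1).primesBelow, χ p * (p : ℂ) ^ (-s)).re +
          2 * ∑ p ∈ (M + 1).primesBelow, ‖χ p * (p : ℂ) ^ (-s)‖ ^ 2) := by
        rw [← Real.exp_sum, Finset.sum_add_distrib, ← Finset.mul_sum, re_sum]
    _ ≤ Real.exp (δ * Real.log (conductor N s.im) + C +
          2 * ∑' n : ℕ, (n : ℝ) ^ (-(1 + 2 * η))) := by
        gcongr
        · exact (re_le_norm _).trans (h N χ hχ s hs M)
        · refine le_trans (Finset.sum_le_sum fun p hp => ?_)
            (hsm.sum_le_tsum _ fun n _ => by positivity)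
          have hp := (Nat.mem_primesBelow.1 hp).2
          have hp0 : (0 : ℝ) < p := by exact_mod_cast hp.pos
          calc _ ≤ ((p : ℝ) ^ (-(1 / 2 + η))) ^ 2 := by gcongr; exact hz p hp
            _ = _ := by
              rw [← Real.rpow_natCast, ← Real.rpow_mul hp0.le]
              congr 1; push_cast; ring
    _ = _ := by
        rw [Real.rpow_def_of_pos hcond, ← Real.exp_add]
        congr 1; ring

lemma two_add_rpow_le {η T : ℝ} (hη : 0 < η) (hη1 : η ≤ 1 / 4) (hT : 1 ≤ T) (ξ : ℝ) :
    ((2 + 2 * Real.pi * |ξ|) ^ η) ^ 2 / (T ^ 2 + ξ ^ 2) ≤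
      T ^ (2 * η - 2) * (100 * (1 + (ξ / T) ^ 2) ^ (-(2 - 2 * η) / 2)) := by
  have hT0 : 0 < T := by linarith
  have hq : 0 < 1 + (ξ / T) ^ 2 := by positivity
  have h1 : T ^ 2 + ξ ^ 2 = T ^ 2 * (1 + (ξ / T) ^ 2) := by field_simp
  have h2 : (2 + 2 * Real.pi * |ξ|) ^ 2 ≤ 100 * (T ^ 2 * (1 + (ξ / T) ^ 2)) := by
    rw [← h1, ← sq_abs ξ]
    have h3 : 2 * Real.pi * |ξ| ≤ 6.4 * |ξ| := by
      gcongr; linarith [Real.pi_lt_d2]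
    have h4 : 0 ≤ 2 * Real.pi * |ξ| := by positivity
    have h5 : (2 + 2 * Real.pi * |ξ|) ^ 2 ≤ (2 + 6.4 * |ξ|) ^ 2 := by gcongr
    nlinarith [sq_nonneg (|ξ| - 1), abs_nonneg ξ]
  have h6 : ((2 + 2 * Real.pi * |ξ|) ^ η) ^ 2 ≤ 100 * (T ^ (2 * η) * (1 + (ξ / T) ^ 2) ^ η) := by
    have hp : 0 ≤ 2 + 2 * Real.pi * |ξ| := by positivity
    calc ((2 + 2 * Real.pi * |ξ|) ^ η) ^ 2 = ((2 + 2 * Real.pi * |ξ|) ^ 2) ^ η := by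
          rw [← Real.rpow_natCast, ← Real.rpow_mul hp, mul_comm η, Real.rpow_mul hp, Real.rpow_natCast]
      _ ≤ (100 * (T ^ 2 * (1 + (ξ / T) ^ 2))) ^ η := by gcongr
      _ = 100 ^ η * (T ^ (2 * η) * (1 + (ξ / T) ^ 2) ^ η) := by
          rw [Real.mul_rpow (by norm_num) (by positivity), Real.mul_rpow (by positivity) hq.le,
            ← Real.rpow_natCast T 2, ← Real.rpow_mul hT0.le]
          norm_num
      _ ≤ _ := by
          gcongr
          calc (100 : ℝ) ^ η ≤ 100 ^ (1 : ℝ) :=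
                Real.rpow_le_rpow_of_exponent_le (by norm_num) (by linarith)
            _ = 100 := Real.rpow_one _
  rw [h1, div_le_iff₀ (by positivity)]
  refine h6.trans (le_of_eq ?_)
  have e1 : T ^ (2 * η) = T ^ (2 * η - 2) * T ^ 2 := by
    rw [← Real.rpow_natCast T 2, ← Real.rpow_add hT0]; norm_num
  have e2 : (1 + (ξ / T) ^ 2) ^ η = (1 + (ξ / T) ^ 2) ^ (-(2 - 2 * η) / 2) * (1 + (ξ / T) ^ 2) := by
    rw [← Real.rpow_add_one hq.ne']; congr 1; ring
  rw [e1, e2]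
  ring

/-- A weighted `L¹` bound for the Fourier transform of a function oscillating on scale `1 / T`. -/
lemma exists_integral_norm_fourier_le {η : ℝ} (hη : 0 < η) (hη1 : η ≤ 1 / 4) :
    ∃ C > 0, ∀ (h : ℝ → ℂ) (K T : ℝ), ContDiff ℝ (⊤ : ℕ∞) h → HasCompactSupport h → 0 ≤ K → 1 ≤ T →
      ∫ v, ‖h v‖ ^ 2 ≤ K → ∫ v, ‖deriv h v‖ ^ 2 ≤ K * T ^ 2 →
      Integrable (fun ξ : ℝ => ‖𝓕 h ξ‖ * (2 + 2 * Real.pi * |ξ|) ^ η) ∧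
      ∫ ξ : ℝ, ‖𝓕 h ξ‖ * (2 + 2 * Real.pi * |ξ|) ^ η ≤ (K + C) * T ^ (1 / 2 + η) := by
  have hk : Integrable fun u : ℝ => 100 * (1 + u ^ 2) ^ (-(2 - 2 * η) / 2) := by
    have := integrable_rpow_neg_one_add_norm_sq (E := ℝ) (μ := volume) (r := 2 - 2 * η)
      (by simp; linarith)
    simpa using this.const_mul 100
  set J := ∫ u : ℝ, 100 * (1 + u ^ 2) ^ (-(2 - 2 * η) / 2) with hJ
  have hJ0 : 0 ≤ J := integral_nonneg fun u => by positivity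
  refine ⟨J + 1, by positivity, ?_⟩
  intro h K T hc hs hK hT hA hB
  have hT0 : 0 < T := by linarith
  have hdc : ContDiff ℝ (⊤ : ℕ∞) (deriv h) := by
    have := hc.iterate_deriv 1
    simpa using this
  set f := hs.toSchwartzMap hc with hf
  set f' := (hs.deriv).toSchwartzMap hdc with hf'
  have hfc : ⇑f = h := rfl
  have hfc' : ⇑f' = deriv h := rfl
  have hFf : ⇑(𝓕 f : SchwartzMap ℝ ℂ) = 𝓕 h := by rw [SchwartzMap.fourier_coe, hfc]
  have hFf' : ⇑(𝓕 f' : SchwartzMap ℝ ℂ) = 𝓕 (deriv h) := by rw [SchwartzMap.fourier_coe, hfc']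
  have hder := Real.fourier_deriv (f := h) (hc.continuous.integrable_of_hasCompactSupport hs)
    (hc.differentiable (by simp)) (hdc.continuous.integrable_of_hasCompactSupport hs.deriv)
  have hP := SchwartzMap.integral_norm_sq_fourier f
  have hP' := SchwartzMap.integral_norm_sq_fourier f'
  have hi : Integrable fun ξ => ‖𝓕 h ξ‖ ^ 2 := by
    have := ((𝓕 f : SchwartzMap ℝ ℂ).memLp 2 volume).integrable_norm_pow (by norm_num)
    rw [hFf] at this
    simpa using this
  have hi' : Integrable fun ξ => ‖𝓕 (deriv h) ξ‖ ^ 2 := by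
    have := ((𝓕 f' : SchwartzMap ℝ ℂ).memLp 2 volume).integrable_norm_pow (by norm_num)
    rw [hFf'] at this
    simpa using this
  rw [hFf, hfc] at hP
  rw [hFf', hfc'] at hP'
  set κ := T ^ (η - 3 / 2) with hκ
  have hκ0 : 0 < κ := by positivity
  set w : ℝ → ℝ := fun ξ => (2 + 2 * Real.pi * |ξ|) ^ η with hw
  have hsum : Integrable fun ξ : ℝ => κ * (T ^ 2 * ‖𝓕 h ξ‖ ^ 2 + ‖𝓕 (deriv h) ξ‖ ^ 2) :=
    ((hi.const_mul _).add hi').const_mul _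
  have hker : Integrable fun ξ : ℝ =>
      κ⁻¹ * (T ^ (2 * η - 2) * (100 * (1 + (ξ / T) ^ 2) ^ (-(2 - 2 * η) / 2))) :=
    ((hk.comp_div hT0.ne').const_mul _).const_mul _
  have hmaj : Integrable fun ξ : ℝ => (κ * (T ^ 2 * ‖𝓕 h ξ‖ ^ 2 + ‖𝓕 (deriv h) ξ‖ ^ 2) +
      κ⁻¹ * (T ^ (2 * η - 2) * (100 * (1 + (ξ / T) ^ 2) ^ (-(2 - 2 * η) / 2)))) / 2 :=
    (hsum.add hker).div_const 2
  have hle : ∀ ξ : ℝ, ‖𝓕 h ξ‖ * w ξ ≤ (κ * (T ^ 2 * ‖𝓕 h ξ‖ ^ 2 + ‖𝓕 (deriv h) ξ‖ ^ 2) +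
      κ⁻¹ * (T ^ (2 * η - 2) * (100 * (1 + (ξ / T) ^ 2) ^ (-(2 - 2 * η) / 2)))) / 2 := by
    intro ξ
    have e1 := two_add_rpow_le hη hη1 hT ξ
    have e2 : T ^ 2 * ‖𝓕 h ξ‖ ^ 2 + ξ ^ 2 * ‖𝓕 h ξ‖ ^ 2 ≤
        T ^ 2 * ‖𝓕 h ξ‖ ^ 2 + ‖𝓕 (deriv h) ξ‖ ^ 2 := by
      rw [hder]
      have : ‖(2 * (Real.pi : ℂ) * I * (ξ : ℂ)) • 𝓕 h ξ‖ ^ 2 = (2 * Real.pi) ^ 2 * (ξ ^ 2 * ‖𝓕 h ξ‖ ^ 2) := by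
        rw [norm_smul, norm_mul, norm_mul, norm_mul, norm_I, norm_real, norm_real, norm_ofNat,
          Real.norm_of_nonneg Real.pi_pos.le, Real.norm_eq_abs, ← sq_abs ξ]
        ring
      simp only at this ⊢
      rw [this]
      have h1 : 1 ≤ (2 * Real.pi) ^ 2 := by nlinarith [Real.pi_gt_three]
      nlinarith [show 0 ≤ ξ ^ 2 * ‖𝓕 h ξ‖ ^ 2 by positivity]
    have hq : 0 < T ^ 2 + ξ ^ 2 := by positivity
    have e3 : ‖𝓕 h ξ‖ * w ξ ≤ (κ * ((T ^ 2 + ξ ^ 2) * ‖𝓕 h ξ‖ ^ 2) +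
        κ⁻¹ * (w ξ ^ 2 / (T ^ 2 + ξ ^ 2))) / 2 := by
      have : 0 ≤ (κ * (T ^ 2 + ξ ^ 2) * ‖𝓕 h ξ‖ - w ξ) ^ 2 / (κ * (T ^ 2 + ξ ^ 2)) := by positivity
      have e : (κ * (T ^ 2 + ξ ^ 2) * ‖𝓕 h ξ‖ - w ξ) ^ 2 / (κ * (T ^ 2 + ξ ^ 2)) =
        κ * ((T ^ 2 + ξ ^ 2) * ‖𝓕 h ξ‖ ^ 2) + κ⁻¹ * (w ξ ^ 2 / (T ^ 2 + ξ ^ 2)) -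
          2 * (‖𝓕 h ξ‖ * w ξ) := by
        field_simp
        ring
      linarith
    refine e3.trans ?_
    rw [add_mul]
    gcongr
  have hw0 : ∀ ξ, 0 ≤ w ξ := fun ξ => by positivity
  have hcF : Continuous (𝓕 h) := by rw [← hFf]; exact (𝓕 f : SchwartzMap ℝ ℂ).continuous
  have hcw : Continuous w := by
    refine Continuous.rpow_const (by fun_prop) fun ξ => Or.inr hη.le
  have hInt : Integrable fun ξ => ‖𝓕 h ξ‖ * w ξ := by
    refine hmaj.mono' ((hcF.norm.mul hcw).aestronglyMeasurable) (ae_of_all _ fun ξ => ?_)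
    rw [Real.norm_of_nonneg (mul_nonneg (norm_nonneg _) (hw0 ξ))]
    exact hle ξ
  refine ⟨hInt, (integral_mono hInt hmaj hle).trans ?_⟩
  rw [integral_div, integral_add hsum hker, integral_const_mul, integral_const_mul,
      integral_const_mul, integral_add (hi.const_mul _) hi', integral_const_mul, hP, hP',
      Measure.integral_comp_div (fun u : ℝ => 100 * (1 + u ^ 2) ^ (-(2 - 2 * η) / 2)), ← hJ,
      abs_of_pos hT0, smul_eq_mul]
  have t1 : κ * T ^ 2 = T ^ (1 / 2 + η) := by
    rw [hκ, ← Real.rpow_natCast T 2, ← Real.rpow_add hT0]; congr 1; norm_num; ring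
  have t2 : κ⁻¹ * (T ^ (2 * η - 2) * (T * J)) = T ^ (1 / 2 + η) * J := by
    have : κ⁻¹ * (T ^ (2 * η - 2) * T) = T ^ (1 / 2 + η) := by
      rw [hκ, ← Real.rpow_neg hT0.le, ← Real.rpow_add_one hT0.ne', ← Real.rpow_add hT0]
      congr 1; ring
    rw [← this]; ring
  rw [t2]
  have t3 : κ * (T ^ 2 * (∫ v, ‖h v‖ ^ 2) + ∫ v, ‖deriv h v‖ ^ 2) ≤ κ * (T ^ 2 * K + K * T ^ 2) := by
    gcongr
  have t4 : κ * (T ^ 2 * K + K * T ^ 2) = 2 * K * T ^ (1 / 2 + η) := by rw [← t1]; ring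
  have t5 : 0 ≤ T ^ (1 / 2 + η) := by positivity
  nlinarith

/-- The function `u ^ σ Φ(u) e(λ u)` in the logarithmic variable `v = log u`. -/
def logProfile (Φ : ℝ → ℝ) (σ lam v : ℝ) : ℂ :=
  ((Real.exp (σ * v) * Φ (Real.exp v) : ℝ) : ℂ) *
    Complex.exp (2 * Real.pi * I * lam * (Real.exp v : ℝ))

lemma hasCompactSupport_comp_exp {Φ : ℝ → ℝ} (hcompact : HasCompactSupport Φ)
    (hsupp : tsupport Φ ⊆ Set.Ioi 0) : HasCompactSupport fun v => Φ (Real.exp v) := by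
  have hK : IsCompact (Set.image Real.log (tsupport Φ)) :=
    hcompact.isCompact.image_of_continuousOn
      (Real.continuousOn_log.mono fun x hx => (hsupp hx).ne')
  refine HasCompactSupport.intro hK fun v hv => ?_
  by_contra h
  exact hv ⟨Real.exp v, subset_tsupport _ h, Real.log_exp v⟩

lemma integrable_sq_of_hasCompactSupport {f : ℝ → ℝ} (hc : Continuous f)
    (hs : HasCompactSupport f) : Integrable fun v => f v ^ 2 := by
  have h : HasCompactSupport fun v => f v * f v := hs.mul_right
  simp_rw [sq]
  exact (hc.mul hc).integrable_of_hasCompactSupport h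

lemma logProfile_facts {Φ : ℝ → ℝ} (hsmooth : ContDiff ℝ (⊤ : ℕ∞) Φ)
    (hcompact : HasCompactSupport Φ) (hsupp : tsupport Φ ⊆ Set.Ioi 0) (σ : ℝ) :
    ∃ K : ℝ, 0 ≤ K ∧ ∀ lam : ℝ, ContDiff ℝ (⊤ : ℕ∞) (logProfile Φ σ lam) ∧
      HasCompactSupport (logProfile Φ σ lam) ∧ ∫ v, ‖logProfile Φ σ lam v‖ ^ 2 ≤ K ∧
      ∫ v, ‖deriv (logProfile Φ σ lam) v‖ ^ 2 ≤ K * (1 + |lam|) ^ 2 := by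
  set φ : ℝ → ℝ := fun v => Real.exp (σ * v) * Φ (Real.exp v) with hφ
  have hφc : ContDiff ℝ (⊤ : ℕ∞) φ := by
    have := hsmooth.comp Real.contDiff_exp
    refine ContDiff.mul (by fun_prop) this
  have hφs : HasCompactSupport φ := (hasCompactSupport_comp_exp hcompact hsupp).mul_left
  have hφd : Continuous (deriv φ) := hφc.continuous_deriv (by simp)
  have hi1 : Integrable fun v => φ v ^ 2 :=
    integrable_sq_of_hasCompactSupport hφc.continuous hφs
  have hi2 : Integrable fun v => 2 * deriv φ v ^ 2 + 80 * (Real.exp v ^ 2 * φ v ^ 2) := by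
    have h1 := integrable_sq_of_hasCompactSupport hφd hφs.deriv
    have h2 := integrable_sq_of_hasCompactSupport (f := fun v => Real.exp v * φ v)
      (Real.continuous_exp.mul hφc.continuous) hφs.mul_left
    simp_rw [mul_pow] at h2
    exact (h1.const_mul 2).add (h2.const_mul 80)
  set K₁ := ∫ v, φ v ^ 2 with hK₁
  set K₂ := ∫ v, (2 * deriv φ v ^ 2 + 80 * (Real.exp v ^ 2 * φ v ^ 2)) with hK₂
  have hK₁0 : 0 ≤ K₁ := integral_nonneg fun v => by positivity
  have hK₂0 : 0 ≤ K₂ := integral_nonneg fun v => by positivity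
  refine ⟨K₁ + K₂, by positivity, fun lam => ?_⟩
  have hn : ∀ v : ℝ, ‖Complex.exp (2 * Real.pi * I * lam * (Real.exp v : ℝ))‖ = 1 := by
    intro v
    rw [show (2 * Real.pi * I * lam * (Real.exp v : ℝ) : ℂ) =
      ((2 * Real.pi * lam * Real.exp v : ℝ) : ℂ) * I by push_cast; ring]
    exact norm_exp_ofReal_mul_I _
  have hcs : HasCompactSupport (logProfile Φ σ lam) :=
    (hφs.comp_left (g := ((↑) : ℝ → ℂ)) ofReal_zero).mul_right
  have hcd : ContDiff ℝ (⊤ : ℕ∞) (logProfile Φ σ lam) := by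
    have h1 : ContDiff ℝ (⊤ : ℕ∞) fun v => ((φ v : ℝ) : ℂ) := ofRealCLM.contDiff.comp hφc
    have h2 : ContDiff ℝ (⊤ : ℕ∞) fun v : ℝ => ((Real.exp v : ℝ) : ℂ) :=
      ofRealCLM.contDiff.comp Real.contDiff_exp
    exact h1.mul ((contDiff_const.mul h2).cexp)
  refine ⟨hcd, hcs, ?_, ?_⟩
  · have : ∀ v, ‖logProfile Φ σ lam v‖ ^ 2 = φ v ^ 2 := by
      intro v
      rw [logProfile, norm_mul, hn, mul_one, norm_real, Real.norm_eq_abs, sq_abs]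
    simp_rw [this]
    linarith
  · have hder : ∀ v, HasDerivAt (logProfile Φ σ lam)
        (((deriv φ v : ℝ) : ℂ) * Complex.exp (2 * Real.pi * I * lam * (Real.exp v : ℝ)) +
          (φ v : ℂ) * (Complex.exp (2 * Real.pi * I * lam * (Real.exp v : ℝ)) *
            (2 * Real.pi * I * lam * (Real.exp v : ℝ)))) v := by
      intro v
      have h1 : HasDerivAt (fun v => ((φ v : ℝ) : ℂ)) ((deriv φ v : ℝ) : ℂ) v :=
        ((hφc.differentiable (by simp) v).hasDerivAt).ofReal_comp
      have h2 : HasDerivAt (fun v : ℝ => ((Real.exp v : ℝ) : ℂ)) ((Real.exp v : ℝ) : ℂ) v :=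
        (Real.hasDerivAt_exp v).ofReal_comp
      exact h1.mul ((h2.const_mul (2 * Real.pi * I * lam : ℂ)).cexp)
    have hle : ∀ v, ‖deriv (logProfile Φ σ lam) v‖ ^ 2 ≤
        (1 + |lam|) ^ 2 * (2 * deriv φ v ^ 2 + 80 * (Real.exp v ^ 2 * φ v ^ 2)) := by
      intro v
      rw [(hder v).deriv]
      have e1 : ‖((deriv φ v : ℝ) : ℂ) * Complex.exp (2 * Real.pi * I * lam * (Real.exp v : ℝ)) +
          (φ v : ℂ) * (Complex.exp (2 * Real.pi * I * lam * (Real.exp v : ℝ)) *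
            (2 * Real.pi * I * lam * (Real.exp v : ℝ)))‖ ≤
          |deriv φ v| + 2 * Real.pi * (|lam| * (Real.exp v * |φ v|)) := by
        refine (norm_add_le _ _).trans (le_of_eq ?_)
        simp only [norm_mul, hn, norm_real, norm_I, Real.norm_eq_abs, abs_of_pos Real.pi_pos,
          abs_of_pos (Real.exp_pos v), norm_ofNat]
        ring
      have e2 : (2 * Real.pi) ^ 2 ≤ 40 := by nlinarith [Real.pi_lt_d2, Real.pi_gt_three]
      set X := |lam| * (Real.exp v * |φ v|) with hX
      calc _ ≤ (|deriv φ v| + 2 * Real.pi * X) ^ 2 := by gcongr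
        _ ≤ 2 * |deriv φ v| ^ 2 + 2 * ((2 * Real.pi) ^ 2 * X ^ 2) := by
            nlinarith [sq_nonneg (|deriv φ v| - 2 * Real.pi * X)]
        _ ≤ 2 * |deriv φ v| ^ 2 + 2 * (40 * X ^ 2) := by gcongr
        _ = 1 * (2 * deriv φ v ^ 2) + |lam| ^ 2 * (80 * (Real.exp v ^ 2 * φ v ^ 2)) := by
            rw [sq_abs, hX, mul_pow, mul_pow, sq_abs (φ v)]; ring
        _ ≤ (1 + |lam|) ^ 2 * (2 * deriv φ v ^ 2) +
            (1 + |lam|) ^ 2 * (80 * (Real.exp v ^ 2 * φ v ^ 2)) := by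
            have := abs_nonneg lam
            gcongr
            · nlinarith
            · linarith
        _ = _ := by ring
    have hci : Integrable fun v => ‖deriv (logProfile Φ σ lam) v‖ ^ 2 :=
      integrable_sq_of_hasCompactSupport (hcd.continuous_deriv (by simp)).norm hcs.deriv.norm
    refine (integral_mono hci (hi2.const_mul _) hle).trans ?_
    rw [integral_const_mul, ← hK₂, mul_comm]
    gcongr
    linarith

/-- Fourier inversion for `logProfile`, written as a Mellin inversion formula. -/
lemma mul_exp_eq_integral {Φ : ℝ → ℝ} {σ lam : ℝ}
    (hcd : ContDiff ℝ (⊤ : ℕ∞) (logProfile Φ σ lam))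
    (hcs : HasCompactSupport (logProfile Φ σ lam)) {u : ℝ} (hu : 0 < u) :
    Complex.exp (2 * Real.pi * I * lam * u) * (Φ u : ℂ) =
      ∫ ξ : ℝ, 𝓕 (logProfile Φ σ lam) ξ * (u : ℂ) ^ (-((σ : ℂ) - 2 * Real.pi * ξ * I)) := by
  set f := hcs.toSchwartzMap hcd with hf
  have hfc : ⇑f = logProfile Φ σ lam := rfl
  have hFf : ⇑(𝓕 f : SchwartzMap ℝ ℂ) = 𝓕 (logProfile Φ σ lam) := by
    rw [SchwartzMap.fourier_coe, hfc]
  have hinv : 𝓕⁻ (𝓕 (logProfile Φ σ lam)) = logProfile Φ σ lam := by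
    refine hcd.continuous.fourierInv_fourier_eq
      (hcd.continuous.integrable_of_hasCompactSupport hcs) ?_
    rw [← hFf]
    exact (𝓕 f : SchwartzMap ℝ ℂ).integrable
  have h1 := congrFun hinv (Real.log u)
  rw [Real.fourierInv_eq', logProfile, Real.exp_log hu, mul_comm σ, Real.exp_mul,
    Real.exp_log hu] at h1
  have huc : (u : ℂ) ≠ 0 := by exact_mod_cast hu.ne'
  have h2 : ∀ ξ : ℝ, 𝓕 (logProfile Φ σ lam) ξ * (u : ℂ) ^ (-((σ : ℂ) - 2 * Real.pi * ξ * I)) =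
      ((u ^ (-σ) : ℝ) : ℂ) * (Complex.exp (((2 * Real.pi * inner ℝ ξ (Real.log u) : ℝ) : ℂ) * I) •
        𝓕 (logProfile Φ σ lam) ξ) := by
    intro ξ
    rw [neg_sub, sub_eq_add_neg, add_comm, cpow_add _ _ huc, ofReal_cpow hu.le, ofReal_neg,
      cpow_def_of_ne_zero huc (2 * Real.pi * ξ * I), ← ofReal_log hu.le, smul_eq_mul]
    have : (Real.log u : ℂ) * (2 * Real.pi * ξ * I) =
        ((2 * Real.pi * inner ℝ ξ (Real.log u) : ℝ) : ℂ) * I := by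
      simp
      ring
    rw [this]
    ring
  simp_rw [h2]
  rw [integral_const_mul, h1, ofReal_mul, ← mul_assoc, ← mul_assoc, ← ofReal_mul,
    ← Real.rpow_add hu]
  simp [mul_comm]

lemma hasSum_smoothNumbers {N : ℕ} (χ : DirichletCharacter ℂ N) {s : ℂ} (hs : 0 < s.re) (M : ℕ) :
    (Summable fun m : (M + 1).smoothNumbers => ‖χ (m : ℕ) * ((m : ℕ) : ℂ) ^ (-s)‖) ∧
      HasSum (fun m : (M + 1).smoothNumbers => χ (m : ℕ) * ((m : ℕ) : ℂ) ^ (-s))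
        (∏ p ∈ (M + 1).primesBelow, (1 - χ p * (p : ℂ) ^ (-s))⁻¹) := by
  have hs0 : s ≠ 0 := by rintro rfl; simp at hs
  refine EulerProduct.summable_and_hasSum_smoothNumbers_prod_primesBelow_geometric
    (f := (dirichletSummandHom χ hs0 : ℕ →* ℂ)) (fun {p} hp => ?_) (M + 1)
  change ‖χ p * (p : ℂ) ^ (-s)‖ < 1
  rw [norm_mul, norm_natCast_cpow_of_pos hp.pos, neg_re]
  calc _ ≤ 1 * (p : ℝ) ^ (-s.re) := by gcongr; exact χ.norm_le_one _
    _ < 1 := by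
      rw [one_mul]
      exact Real.rpow_lt_one_of_one_lt_of_neg (by exact_mod_cast hp.one_lt) (by linarith)

/-- The GRH bound for smooth-weighted sums of a nontrivial character over smooth numbers. -/
lemma exists_norm_tsum_smoothNumbers_le
    (hG : ∀ (N : ℕ) [NeZero N] (χ : DirichletCharacter ℂ N) (s : ℂ),
      0 < s.re → s.re < 1 → DirichletCharacter.LFunction χ s = 0 → s.re = 1 / 2)
    {Φ : ℝ → ℝ} (hsmooth : ContDiff ℝ (⊤ : ℕ∞) Φ)
    (hcompact : HasCompactSupport Φ) (hsupp : tsupport Φ ⊆ Set.Ioi 0)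
    {η : ℝ} (hη : 0 < η) (hη1 : η ≤ 1 / 4) :
    ∃ C > 0, ∀ (N : ℕ) [NeZero N] (χ : DirichletCharacter ℂ N), χ ≠ 1 →
      ∀ (M : ℕ) (X lam : ℝ), 0 < X →
      ‖∑' m : (M + 1).smoothNumbers, χ (m : ℕ) *
        (Complex.exp (2 * Real.pi * I * lam * ((m : ℕ) / X : ℝ)) * (Φ ((m : ℕ) / X) : ℂ))‖ ≤
      C * X ^ (1 / 2 + η) * (N : ℝ) ^ η * (1 + |lam|) ^ (1 / 2 + η) := by
  obtain ⟨C₁, hC₁, h₁⟩ := exists_norm_prod_primesBelow_le hG hη (by linarith) hη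
  obtain ⟨C₂, hC₂, h₂⟩ := exists_integral_norm_fourier_le hη hη1
  obtain ⟨K, hK, h₃⟩ := logProfile_facts hsmooth hcompact hsupp (1 / 2 + η)
  refine ⟨C₁ * (K + C₂), by positivity, ?_⟩
  intro N _ χ hχ M X lam hX
  obtain ⟨hcd, hcs, hA, hB⟩ := h₃ lam
  obtain ⟨hInt, hbound⟩ := h₂ _ K (1 + |lam|) hcd hcs hK (by linarith [abs_nonneg lam]) hA hB
  set h := logProfile Φ (1 / 2 + η) lam with hh
  set s : ℝ → ℂ := fun ξ => ((1 / 2 + η : ℝ) : ℂ) - 2 * Real.pi * ξ * I with hs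
  have hsre : ∀ ξ, (s ξ).re = 1 / 2 + η := fun ξ => by simp [hs]
  have hsim : ∀ ξ, (s ξ).im = -(2 * Real.pi * ξ) := fun ξ => by simp [hs]
  have hXc : (X : ℂ) ≠ 0 := by exact_mod_cast hX.ne'
  have hFint : Integrable (𝓕 h) := by
    have : ⇑(𝓕 (hcs.toSchwartzMap hcd) : SchwartzMap ℝ ℂ) = 𝓕 h := SchwartzMap.fourier_coe _
    rw [← this]
    exact (𝓕 (hcs.toSchwartzMap hcd) : SchwartzMap ℝ ℂ).integrable
  have hsc : Continuous s := by fun_prop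
  set F : (M + 1).smoothNumbers → ℝ → ℂ := fun m ξ =>
    𝓕 h ξ * (X : ℂ) ^ (s ξ) * (χ (m : ℕ) * ((m : ℕ) : ℂ) ^ (-(s ξ))) with hF
  have hmpos : ∀ m : (M + 1).smoothNumbers, 0 < (m : ℕ) := fun m =>
    Nat.pos_of_ne_zero (Nat.ne_zero_of_mem_smoothNumbers m.2)
  have hterm : ∀ m : (M + 1).smoothNumbers, χ (m : ℕ) *
      (Complex.exp (2 * Real.pi * I * lam * ((m : ℕ) / X : ℝ)) * (Φ ((m : ℕ) / X) : ℂ)) =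
      ∫ ξ, F m ξ := by
    intro m
    have hm : (0 : ℝ) < (m : ℕ) := by exact_mod_cast hmpos m
    rw [mul_exp_eq_integral hcd hcs (div_pos hm hX), ← integral_const_mul]
    congr 1
    ext ξ
    have e1 : (((m : ℕ) / X : ℝ) : ℂ) ^ (-(s ξ)) = ((m : ℕ) : ℂ) ^ (-(s ξ)) * (X : ℂ) ^ (s ξ) := by
      rw [div_eq_mul_inv, ofReal_mul, mul_cpow_ofReal_nonneg hm.le (by positivity), ofReal_inv,
        inv_cpow _ _ (by rw [arg_ofReal_of_nonneg hX.le]; exact Real.pi_pos.ne), ← cpow_neg, neg_neg,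
        ofReal_natCast]
    change χ (m : ℕ) * (𝓕 h ξ * (((m : ℕ) / X : ℝ) : ℂ) ^ (-(s ξ))) = F m ξ
    simp only [hF]
    rw [e1]
    ring
  have hnorm : ∀ m ξ, ‖F m ξ‖ = X ^ (1 / 2 + η) *
      ‖χ (m : ℕ) * ((m : ℕ) : ℂ) ^ (-((1 / 2 + η : ℝ) : ℂ))‖ * ‖𝓕 h ξ‖ := by
    intro m ξ
    simp only [hF]
    rw [norm_mul, norm_mul, norm_mul, norm_mul, norm_cpow_eq_rpow_re_of_pos hX,
      norm_natCast_cpow_of_pos (hmpos m), norm_natCast_cpow_of_pos (hmpos m), neg_re, neg_re, hsre,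
      ofReal_re]
    ring
  have hsum := hasSum_integral_of_summable_integral_norm (F := F) (μ := volume) ?_ ?_
  · simp_rw [hterm]
    rw [hsum.tsum_eq]
    have hprod : ∀ ξ, ∑' m, F m ξ = 𝓕 h ξ * (X : ℂ) ^ (s ξ) *
        ∏ p ∈ (M + 1).primesBelow, (1 - χ p * (p : ℂ) ^ (-(s ξ)))⁻¹ := by
      intro ξ
      simp only [hF]
      rw [tsum_mul_left, (hasSum_smoothNumbers χ (by rw [hsre]; linarith) M).2.tsum_eq]
    simp_rw [hprod]
    refine (norm_integral_le_of_norm_le (hInt.const_mul (C₁ * X ^ (1 / 2 + η) * (N : ℝ) ^ η))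
      (ae_of_all _ fun ξ => ?_)).trans ?_
    · rw [norm_mul, norm_mul, norm_cpow_eq_rpow_re_of_pos hX, hsre]
      have := h₁ N χ hχ (s ξ) (hsre ξ) M
      have hc : conductor N (s ξ).im ^ η = (N : ℝ) ^ η * (2 + 2 * Real.pi * |ξ|) ^ η := by
        rw [conductor, hsim, abs_neg, abs_mul, abs_of_pos (by positivity : 0 < 2 * Real.pi),
          Real.mul_rpow (by positivity) (by positivity), add_comm (2 : ℝ)]
      rw [hc] at this
      calc _ ≤ ‖𝓕 h ξ‖ * X ^ (1 / 2 + η) * (C₁ * ((N : ℝ) ^ η * (2 + 2 * Real.pi * |ξ|) ^ η)) := by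
            gcongr
        _ = _ := by ring
    · rw [integral_const_mul]
      calc _ ≤ C₁ * X ^ (1 / 2 + η) * (N : ℝ) ^ η * ((K + C₂) * (1 + |lam|) ^ (1 / 2 + η)) := by
            gcongr
        _ = _ := by ring
  · intro m
    refine (hFint.norm.const_mul (X ^ (1 / 2 + η) *
      ‖χ (m : ℕ) * ((m : ℕ) : ℂ) ^ (-((1 / 2 + η : ℝ) : ℂ))‖)).mono' ?_
      (ae_of_all _ fun ξ => (hnorm m ξ).le)
    have hmc : ((m : ℕ) : ℂ) ≠ 0 := by exact_mod_cast (hmpos m).ne'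
    refine (hFint.aestronglyMeasurable.mul ?_).mul ?_
    · exact (hsc.const_cpow (Or.inl hXc)).aestronglyMeasurable
    · exact (continuous_const.mul (hsc.neg.const_cpow (Or.inl hmc))).aestronglyMeasurable
  · simp_rw [hnorm, integral_const_mul]
    exact ((hasSum_smoothNumbers χ (s := ((1 / 2 + η : ℝ) : ℂ))
      (by rw [ofReal_re]; linarith) M).1.mul_left _).mul_right _

lemma sum_nthRootsFinset {n : ℕ} (hn : 0 < n) :
    ∑ ζ ∈ Polynomial.nthRootsFinset n (1 : ℂ), ζ = if n = 1 then 1 else 0 := by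
  have hζ := Complex.isPrimitiveRoot_exp n hn.ne'
  have : NeZero n := ⟨hn.ne'⟩
  have : ∑ ζ ∈ Polynomial.nthRootsFinset n (1 : ℂ), ζ =
      ∑ i ∈ Finset.range n, cexp (2 * Real.pi * I / n) ^ i := by
    symm
    refine Finset.sum_nbij (fun i => cexp (2 * Real.pi * I / n) ^ i) ?_ ?_ ?_ (fun _ _ => rfl)
    · intro i _
      rw [Polynomial.mem_nthRootsFinset hn, ← pow_mul, mul_comm i n, pow_mul, hζ.pow_eq_one, one_pow]
    · intro i hi j hj hij
      exact hζ.pow_inj (by simpa using hi) (by simpa using hj) hij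
    · intro z hz
      obtain ⟨i, hi, rfl⟩ := hζ.eq_pow_of_pow_eq_one ((Polynomial.mem_nthRootsFinset hn 1).1 hz)
      exact ⟨i, by simpa using hi, rfl⟩
  rw [this]
  split_ifs with h
  · subst h; simp
  · exact hζ.geom_sum_eq_zero (by omega)

/-- The sum of the primitive `n`-th roots of unity is `μ n`. -/
lemma sum_primitiveRoots {n : ℕ} (hn : 0 < n) :
    ∑ ζ ∈ primitiveRoots n ℂ, ζ = (ArithmeticFunction.moebius n : ℂ) := by
  have key : ∀ m > 0, ∑ d ∈ m.divisors, ∑ ζ ∈ primitiveRoots d ℂ, ζ =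
      (fun m : ℕ => if m = 1 then (1 : ℂ) else 0) m := by
    intro m hm
    rw [← Finset.sum_biUnion fun a _ b _ hab => IsPrimitiveRoot.disjoint hab,
      ← IsPrimitiveRoot.nthRoots_one_eq_biUnion_primitiveRoots]
    exact sum_nthRootsFinset hm
  rw [← ArithmeticFunction.sum_eq_iff_sum_mul_moebius_eq.1 key n hn,
    Finset.sum_eq_single (n, 1)]
  · simp
  · rintro ⟨a, b⟩ hab hne
    have hb : b ≠ 1 := by
      rintro rfl
      exact hne (by simp [← (Nat.mem_divisorsAntidiagonal.1 hab).1])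
    simp [hb]
  · simp [hn.ne']

lemma sum_units_stdAddChar (r : ℕ) [NeZero r] (a : (ZMod r)ˣ) :
    ∑ u : (ZMod r)ˣ, ZMod.stdAddChar ((a : ZMod r) * (u : ZMod r)) = (ArithmeticFunction.moebius r : ℂ) := by
  have hr : 0 < r := NeZero.pos r
  have hshift := Equiv.sum_comp (Equiv.mulLeft a)
    (fun u : (ZMod r)ˣ => (ZMod.stdAddChar (u : ZMod r) : ℂ))
  simp only [Equiv.coe_mulLeft, Units.val_mul] at hshift
  rw [← sum_primitiveRoots hr, hshift]
  have hζ := Complex.isPrimitiveRoot_exp r hr.ne'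
  have hpow : ∀ i : ℕ, (ZMod.stdAddChar (i : ZMod r) : ℂ) = cexp (2 * Real.pi * I / r) ^ i := by
    intro i
    rw [← Complex.exp_nat_mul]
    have := ZMod.stdAddChar_coe (N := r) (i : ℤ)
    rw [Int.cast_natCast] at this
    rw [this]
    congr 1
    push_cast
    ring
  refine Finset.sum_nbij (fun u : (ZMod r)ˣ => ZMod.stdAddChar (u : ZMod r)) ?_ ?_ ?_
    (fun _ _ => rfl)
  · intro u _
    rw [mem_primitiveRoots hr]
    have := hpow (u : ZMod r).val
    rw [ZMod.natCast_zmod_val] at this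
    simp only [this]
    exact hζ.pow_of_coprime _ (ZMod.val_coe_unit_coprime u)
  · intro u _ v _ huv
    exact Units.ext (ZMod.injective_stdAddChar huv)
  · intro z hz
    obtain ⟨i, -, hi, rfl⟩ := hζ.isPrimitiveRoot_iff.1 (isPrimitiveRoot_of_mem_primitiveRoots hz)
    exact ⟨ZMod.unitOfCoprime i hi, by simp, by simp [hpow]⟩

/-- Plancherel on `(ZMod r)ˣ`, for functions of absolute value one. -/
lemma sum_norm_sq_char_coeff (r : ℕ) [NeZero r] (f : (ZMod r)ˣ → ℂ) (hf : ∀ u, ‖f u‖ = 1) :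
    ∑ χ : DirichletCharacter ℂ r,
      ‖(r.totient : ℂ)⁻¹ * ∑ u : (ZMod r)ˣ, f u * χ (u : ZMod r)⁻¹‖ ^ 2 = 1 := by
  have ht : (r.totient : ℂ) ≠ 0 := by exact_mod_cast (Nat.totient_pos.2 (NeZero.pos r)).ne'
  have hstar : ∀ (χ : DirichletCharacter ℂ r) (u : (ZMod r)ˣ),
      (starRingEnd ℂ) (χ (u : ZMod r)⁻¹) = χ u := by
    intro χ u
    have := MulChar.star_apply' χ⁻¹ (u : ZMod r)
    rw [inv_inv, MulChar.inv_apply, Ring.inverse_unit, ← ZMod.inv_coe_unit] at this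
    exact this
  have hexp : ∀ χ : DirichletCharacter ℂ r,
      ((‖(r.totient : ℂ)⁻¹ * ∑ u : (ZMod r)ˣ, f u * χ (u : ZMod r)⁻¹‖ ^ 2 : ℝ) : ℂ) =
      ((r.totient : ℂ)⁻¹) ^ 2 * ∑ u : (ZMod r)ˣ, ∑ v : (ZMod r)ˣ,
        f u * (starRingEnd ℂ) (f v) * (χ (u : ZMod r)⁻¹ * χ v) := by
    intro χ
    rw [ofReal_pow, ← Complex.mul_conj', map_mul, map_sum, map_inv₀, map_natCast]
    simp_rw [map_mul, hstar]
    rw [mul_mul_mul_comm, Finset.sum_mul_sum, sq]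
    congr 1
    refine Finset.sum_congr rfl fun u _ => Finset.sum_congr rfl fun v _ => by ring
  apply ofReal_injective
  rw [ofReal_sum]
  simp_rw [hexp]
  rw [← Finset.mul_sum, Finset.sum_comm]
  have : ∀ u : (ZMod r)ˣ, ∑ χ : DirichletCharacter ℂ r, ∑ v : (ZMod r)ˣ,
      f u * (starRingEnd ℂ) (f v) * (χ (u : ZMod r)⁻¹ * χ v) = r.totient := by
    intro u
    rw [Finset.sum_comm]
    simp_rw [← Finset.mul_sum, DirichletCharacter.sum_char_inv_mul_char_eq ℂ u.isUnit,
      Units.val_inj]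
    simp [Complex.mul_conj', hf]
  simp_rw [this]
  rw [Finset.sum_const, Finset.card_univ, ZMod.card_units_eq_totient, nsmul_eq_mul, ofReal_one]
  field_simp

/-- Expansion of `m ↦ e(am/r) - μ(r)/φ(r)` in nontrivial Dirichlet characters modulo `r`. -/
lemma exists_char_expansion (r : ℕ) [NeZero r] (a : ℤ) (ha : IsCoprime a (r : ℤ)) :
    ∃ c : DirichletCharacter ℂ r → ℂ,
      (∑ χ ∈ Finset.univ.erase 1, ‖c χ‖ ≤ Real.sqrt r) ∧
      ∀ m : ℕ, m.Coprime r →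
        cexp (2 * Real.pi * I * (a * m / r)) -
          ((((ArithmeticFunction.moebius r : ℝ) / (r.totient : ℝ) : ℝ)) : ℂ) =
        ∑ χ ∈ Finset.univ.erase 1, c χ * χ m := by
  have ht0 : 0 < r.totient := Nat.totient_pos.2 (NeZero.pos r)
  have ht : (r.totient : ℂ) ≠ 0 := by exact_mod_cast ht0.ne'
  obtain ⟨a', ha'⟩ : IsUnit ((a : ℤ) : ZMod r) := (ZMod.coe_int_isUnit_iff_isCoprime a r).2 ha.symm
  set f : (ZMod r)ˣ → ℂ := fun u => ZMod.stdAddChar ((a' : ZMod r) * (u : ZMod r)) with hf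
  have hf1 : ∀ u, ‖f u‖ = 1 := fun u => Circle.norm_coe _
  set c : DirichletCharacter ℂ r → ℂ := fun χ =>
    (r.totient : ℂ)⁻¹ * ∑ u : (ZMod r)ˣ, f u * χ (u : ZMod r)⁻¹ with hc
  have hcard : Fintype.card (DirichletCharacter ℂ r) = r.totient := by
    rw [← Nat.card_eq_fintype_card,
      DirichletCharacter.card_eq_totient_of_hasEnoughRootsOfUnity ℂ r]
  have hc1 : c 1 = ((((ArithmeticFunction.moebius r : ℝ) / (r.totient : ℝ) : ℝ)) : ℂ) := by
    have : ∀ u : (ZMod r)ˣ, (1 : DirichletCharacter ℂ r) (u : ZMod r)⁻¹ = 1 := fun u => by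
      rw [ZMod.inv_coe_unit]; exact MulChar.one_apply_coe _
    simp only [hc, this, mul_one, hf]
    rw [sum_units_stdAddChar]
    push_cast
    rw [div_eq_inv_mul]
  refine ⟨c, ?_, fun m hm => ?_⟩
  · calc ∑ χ ∈ Finset.univ.erase 1, ‖c χ‖ ≤ ∑ χ, ‖c χ‖ :=
          Finset.sum_le_sum_of_subset_of_nonneg (Finset.erase_subset _ _)
            fun _ _ _ => norm_nonneg _
      _ ≤ Real.sqrt r := by
        refine Real.le_sqrt_of_sq_le ?_
        calc (∑ χ, ‖c χ‖) ^ 2 ≤ (Finset.univ : Finset (DirichletCharacter ℂ r)).card *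
              ∑ χ, ‖c χ‖ ^ 2 := sq_sum_le_card_mul_sum_sq
          _ = r.totient := by
            rw [sum_norm_sq_char_coeff r f hf1, Finset.card_univ, hcard, mul_one]
          _ ≤ r := by exact_mod_cast Nat.totient_le r
  · have hinv : ∑ χ, c χ * χ (m : ZMod r) = f (ZMod.unitOfCoprime m hm) := by
      simp only [hc, mul_assoc, ← Finset.mul_sum, Finset.sum_mul]
      rw [Finset.sum_comm]
      simp_rw [← Finset.mul_sum, DirichletCharacter.sum_char_inv_mul_char_eq ℂ (Units.isUnit _)]
      rw [← ZMod.coe_unitOfCoprime m hm]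
      simp only [Units.val_inj]
      simp
      field_simp
    have hone : (1 : DirichletCharacter ℂ r) (m : ZMod r) = 1 := by
      rw [← ZMod.coe_unitOfCoprime m hm]; exact MulChar.one_apply_coe _
    have hfm : f (ZMod.unitOfCoprime m hm) = cexp (2 * Real.pi * I * (a * m / r)) := by
      simp only [hf, ha', ZMod.coe_unitOfCoprime]
      have := ZMod.stdAddChar_coe (N := r) (a * m)
      push_cast at this
      rw [this]
      congr 1
      ring
    rw [← hfm, ← hinv, ← Finset.add_sum_erase _ _ (Finset.mem_univ 1), hone, hc1]
    ring

lemma summable_of_eq_zero {Φ : ℝ → ℝ} (hcompact : HasCompactSupport Φ) {X : ℝ} (hX : 0 < X)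
    {g : ℕ → ℂ} (hg : ∀ n : ℕ, Φ (n / X) = 0 → g n = 0) : Summable g := by
  obtain ⟨B, hB⟩ := hcompact.isCompact.bddAbove
  refine summable_of_hasFiniteSupport ((Set.finite_Iic ⌊B * X⌋₊).subset fun n hn => ?_)
  refine Nat.le_floor ?_
  rw [← div_le_iff₀ hX]
  exact hB (subset_tsupport Φ fun h => hn (hg n h))

/-- Reduction of the local main term to sums of nontrivial Dirichlet characters, by sorting the
integers `n` according to `gcd(q, n)`. -/
lemma norm_tsum_le_sum_divisors {Φ : ℝ → ℝ} (hcompact : HasCompactSupport Φ) {x : ℝ} (hx : 0 < x)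
    {q : ℕ} (hq : 0 < q) {a : ℤ} (ha : IsCoprime a (q : ℤ)) (γ : ℝ) (M : ℕ) {b : ℕ → ℝ}
    (hb0 : ∀ d, 0 ≤ b d)
    (hb : ∀ d ∈ q.divisors, ∀ χ : DirichletCharacter ℂ (q / d), χ ≠ 1 →
      ‖∑' m : (M + 1).smoothNumbers, χ (m : ℕ) *
        (cexp (2 * Real.pi * I * ((d * (m : ℕ) : ℕ) * γ)) * (Φ ((d * (m : ℕ) : ℕ) / x) : ℂ))‖ ≤
        b d) :
    ‖∑' n : (M + 1).smoothNumbers,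
      (cexp (2 * Real.pi * I * (a * (n : ℕ) / q)) -
        ((((ArithmeticFunction.moebius (q / q.gcd n) : ℝ) / ((q / q.gcd n).totient : ℝ) : ℝ)) : ℂ))
        * (cexp (2 * Real.pi * I * ((n : ℕ) * γ)) * (Φ ((n : ℕ) / x) : ℂ))‖ ≤
      ∑ d ∈ q.divisors, Real.sqrt ((q / d : ℕ) : ℝ) * b d := by
  set S := (M + 1).smoothNumbers with hS
  set w : ℕ → ℂ := fun n => cexp (2 * Real.pi * I * (n * γ)) * (Φ (n / x) : ℂ) with hw
  set G : ℕ → ℂ := fun n => (cexp (2 * Real.pi * I * (a * n / q)) -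
    ((((ArithmeticFunction.moebius (q / q.gcd n) : ℝ) / ((q / q.gcd n).totient : ℝ) : ℝ)) : ℂ))
      * w n with hG
  change ‖∑' n : S, G n‖ ≤ _
  have hw0 : ∀ n : ℕ, Φ (n / x) = 0 → w n = 0 := fun n hn => by simp [hw, hn]
  have hsplit : S.indicator G =
      fun n => ∑ d ∈ q.divisors, if q.gcd n = d then S.indicator G n else 0 := by
    ext n
    rw [Finset.sum_ite_eq, if_pos (Nat.mem_divisors.2 ⟨Nat.gcd_dvd_left _ _, hq.ne'⟩)]
  rw [tsum_subtype S G, hsplit, Summable.tsum_finsetSum fun d _ =>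
    summable_of_eq_zero hcompact hx fun n hn => by simp [Set.indicator, hG, hw0 n hn]]
  refine (norm_sum_le _ _).trans (Finset.sum_le_sum fun d hd => ?_)
  have hdq := Nat.dvd_of_mem_divisors hd
  have hd0 : 0 < d := Nat.pos_of_dvd_of_pos hdq hq
  have hinj : Function.Injective (fun m : ℕ => d * m) := mul_right_injective₀ hd0.ne'
  rw [← hinj.tsum_eq fun n hn => ?_]
  swap
  · have : q.gcd n = d := by
      by_contra h
      simp [h] at hn
    obtain ⟨m, rfl⟩ : d ∣ n := this ▸ Nat.gcd_dvd_right q n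
    exact ⟨m, rfl⟩
  by_cases hdS : d ∈ S
  swap
  · have : ∀ m : ℕ, S.indicator G (d * m) = 0 := fun m =>
      Set.indicator_of_notMem (fun h => hdS (Nat.mem_smoothNumbers_of_dvd h (dvd_mul_right d m))) _
    simp only [this, ite_self, tsum_zero, norm_zero]
    exact mul_nonneg (Real.sqrt_nonneg _) (hb0 d)
  set r := q / d with hr
  have hqr : d * r = q := Nat.mul_div_cancel' hdq
  have hr0 : 0 < r := Nat.div_pos (Nat.le_of_dvd hq hdq) hd0
  have : NeZero r := ⟨hr0.ne'⟩
  have har : IsCoprime a (r : ℤ) := by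
    refine ha.of_isCoprime_of_dvd_right ?_
    exact_mod_cast Dvd.intro_left d hqr
  obtain ⟨c, hc, hexp⟩ := exists_char_expansion r a har
  have hterm : ∀ m : ℕ, (if q.gcd (d * m) = d then S.indicator G (d * m) else 0) =
      ∑ χ ∈ Finset.univ.erase 1, c χ * S.indicator (fun m => χ m * w (d * m)) m := by
    intro m
    have hgcd : q.gcd (d * m) = d * r.gcd m := by rw [← hqr, Nat.gcd_mul_left]
    have hmem : d * m ∈ S ↔ m ∈ S :=
      ⟨fun h => Nat.mem_smoothNumbers_of_dvd h (dvd_mul_left m d),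
        fun h => Nat.mul_mem_smoothNumbers hdS h⟩
    by_cases hmS : m ∈ S
    swap
    · simp [Set.indicator_of_notMem hmS, Set.indicator_of_notMem (mt hmem.1 hmS)]
    simp_rw [Set.indicator_of_mem hmS]
    rw [Set.indicator_of_mem (hmem.2 hmS), hgcd]
    by_cases hcop : r.gcd m = 1
    · rw [hcop, mul_one, if_pos rfl]
      have hd0c : (d : ℂ) ≠ 0 := by exact_mod_cast hd0.ne'
      have hr0c : (r : ℂ) ≠ 0 := by exact_mod_cast hr0.ne'
      have hq' : (a * (d * m : ℕ) / q : ℂ) = a * m / r := by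
        rw [← hqr]
        push_cast
        field_simp
      simp only [hG]
      rw [hgcd, hcop, mul_one, ← hr, hq', hexp m (Nat.coprime_comm.1 hcop), Finset.sum_mul]
      exact Finset.sum_congr rfl fun χ _ => mul_assoc _ _ _
    · have hne : d * r.gcd m ≠ d := fun h => hcop (Nat.eq_of_mul_eq_mul_left hd0 (by rw [h, mul_one]))
      rw [if_neg hne]
      refine (Finset.sum_eq_zero fun χ _ => ?_).symm
      have : χ (m : ZMod r) = 0 := χ.map_nonunit fun h =>
        hcop (Nat.coprime_comm.1 ((ZMod.isUnit_iff_coprime m r).1 h))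
      rw [this, zero_mul, mul_zero]
  simp_rw [hterm]
  have hsummable : ∀ χ : DirichletCharacter ℂ r,
      Summable (S.indicator (fun m : ℕ => χ m * w (d * m))) := fun χ =>
    summable_of_eq_zero hcompact (X := x / d) (by positivity) fun m hm => by
      have : w (d * m) = 0 := hw0 _ (by
        rw [← hm]
        congr 1
        push_cast
        field_simp)
      simp [Set.indicator, this]
  rw [Summable.tsum_finsetSum fun χ _ => (hsummable χ).mul_left _]
  calc _ ≤ ∑ χ ∈ Finset.univ.erase 1, ‖c χ‖ * b d := by
        refine (norm_sum_le _ _).trans (Finset.sum_le_sum fun χ hχ => ?_)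
        rw [tsum_mul_left, norm_mul, ← tsum_subtype S (fun m : ℕ => χ m * w (d * m))]
        gcongr
        exact hb d hd χ (Finset.ne_of_mem_erase hχ)
    _ ≤ _ := by
        rw [← Finset.sum_mul]
        exact mul_le_mul_of_nonneg_right hc (hb0 d)

end SmoothExpSum

theorem exponential_sum_local_main_term (hGRH : GRH)
    (Φ : ℝ → ℝ) (hsmooth : ContDiff ℝ (⊤ : ℕ∞) Φ) (hcompact : HasCompactSupport Φ)
    (hsupp : tsupport Φ ⊆ Set.Ioi 0) (ε : ℝ) (hε : 0 < ε) :
    ∃ C > (0 : ℝ), ∃ x₀ : ℝ, ∀ x ≥ x₀, ∀ y : ℝ, 2 ≤ y →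
      ∀ (α γ : ℝ) (a : ℤ) (q : ℕ), α ∈ Set.Icc (0 : ℝ) 1 →
        Int.gcd a (q : ℤ) = 1 → 1 ≤ q → (q : ℝ) ≤ Real.sqrt x →
        α = (a : ℝ) / (q : ℝ) + γ → |γ| ≤ 1 / ((q : ℝ) * Real.sqrt x) →
        ‖Esum x y Φ α - Mterm x y Φ q γ‖ ≤ C * x ^ ((3 : ℝ) / 4 + ε) := by
  obtain ⟨C, hC, hmain⟩ := SmoothExpSum.exists_norm_tsum_smoothNumbers_le hGRH.2 hsmooth hcompact
    hsupp (η := min (ε / 2) (1 / 4)) (lt_min (by linarith) (by norm_num)) (min_le_right _ _)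
  set η := min (ε / 2) (1 / 4) with hη_def
  have hη : 0 < η := lt_min (by linarith) (by norm_num)
  have hηε : η ≤ ε / 2 := min_le_left _ _
  have hZs : Summable fun n : ℕ => (n : ℝ) ^ (-(1 + η)) :=
    Real.summable_nat_rpow.2 (by linarith)
  set Z := ∑' n : ℕ, (n : ℝ) ^ (-(1 + η)) with hZ
  have hZ0 : 0 ≤ Z := tsum_nonneg fun n => by positivity
  refine ⟨C * 2 ^ (1 / 2 + η) * (Z + 1), by positivity, 1, ?_⟩
  intro x hx y hy α γ a q _ hgcd hq hqx hα hγ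
  have hx0 : 0 < x := by linarith
  have hq0 : (0 : ℝ) < q := by exact_mod_cast hq
  have hqc : (q : ℂ) ≠ 0 := by exact_mod_cast hq0.ne'
  have hcop : IsCoprime a (q : ℤ) := Int.isCoprime_iff_gcd_eq_one.2 hgcd
  set L := 1 + |γ * x| with hL
  have hqL : q * L ≤ 2 * Real.sqrt x := by
    have h1 : |γ * x| ≤ Real.sqrt x / q := by
      rw [abs_mul, abs_of_pos hx0]
      calc |γ| * x ≤ 1 / (q * Real.sqrt x) * x := by gcongr
        _ = Real.sqrt x / q := by
          nth_rewrite 2 [← Real.mul_self_sqrt hx0.le]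
          have : Real.sqrt x ≠ 0 := (Real.sqrt_pos.2 hx0).ne'
          field_simp
    have h2 : q * |γ * x| ≤ Real.sqrt x := by
      rw [le_div_iff₀ hq0] at h1
      linarith
    rw [hL]
    linarith
  have hset : {n : ℕ | 0 < n ∧ ∀ p : ℕ, p.Prime → p ∣ n → (p : ℝ) ≤ y} =
      (⌊y⌋₊ + 1).smoothNumbers := by
    ext n
    simp only [Set.mem_ofPred_eq, Nat.mem_smoothNumbers', Nat.lt_succ_iff,
      Nat.le_floor_iff (by linarith : 0 ≤ y)]
    refine ⟨fun h => h.2, fun h => ⟨Nat.pos_of_ne_zero ?_, h⟩⟩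
    rintro rfl
    obtain ⟨p, hp, hprime⟩ := Nat.exists_infinite_primes (⌊y⌋₊ + 1)
    have := Nat.le_floor (h p hprime (dvd_zero p))
    omega
  have hdiff : Esum x y Φ α - Mterm x y Φ q γ = ∑' n : (⌊y⌋₊ + 1).smoothNumbers,
      (Complex.exp (2 * Real.pi * Complex.I * (a * (n : ℕ) / q)) -
        ((((ArithmeticFunction.moebius (q / q.gcd n) : ℝ) / ((q / q.gcd n).totient : ℝ) : ℝ)) : ℂ))
        * (Complex.exp (2 * Real.pi * Complex.I * ((n : ℕ) * γ)) * (Φ ((n : ℕ) / x) : ℂ)) := by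
    rw [Esum, Mterm, ← Summable.tsum_sub]
    · refine Eq.trans ?_ (tsum_congr_set_coe (fun n : ℕ =>
        (Complex.exp (2 * Real.pi * Complex.I * (a * n / q)) -
        ((((ArithmeticFunction.moebius (q / q.gcd n) : ℝ) / ((q / q.gcd n).totient : ℝ) : ℝ)) : ℂ))
        * (Complex.exp (2 * Real.pi * Complex.I * (n * γ)) * (Φ (n / x) : ℂ))) hset)
      refine tsum_congr fun n => ?_
      have : Complex.exp (2 * Real.pi * Complex.I * (n : ℕ) * α) =
          Complex.exp (2 * Real.pi * Complex.I * (a * (n : ℕ) / q)) *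
            Complex.exp (2 * Real.pi * Complex.I * ((n : ℕ) * γ)) := by
        rw [← Complex.exp_add, hα]
        congr 1
        push_cast
        field_simp
      rw [this, mul_assoc _ ((n : ℕ) : ℂ) (γ : ℂ)]
      ring
    · exact (SmoothExpSum.summable_of_eq_zero hcompact hx0 (g := fun n : ℕ =>
        Complex.exp (2 * Real.pi * Complex.I * n * α) * (Φ (n / x) : ℂ))
        fun n hn => by simp [hn]).subtype _
    · exact (SmoothExpSum.summable_of_eq_zero hcompact hx0 (g := fun n : ℕ =>
        ((((ArithmeticFunction.moebius (q / q.gcd n) : ℝ) / ((q / q.gcd n).totient : ℝ) : ℝ)) : ℂ) *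
          Complex.exp (2 * Real.pi * Complex.I * n * γ) * (Φ (n / x) : ℂ))
        fun n hn => by simp [hn]).subtype _
  rw [hdiff]
  have hL0 : 0 < L := by positivity
  refine (SmoothExpSum.norm_tsum_le_sum_divisors hcompact hx0 hq hcop γ ⌊y⌋₊
    (b := fun d => C * (x / d) ^ (1 / 2 + η) * (q : ℝ) ^ η * L ^ (1 / 2 + η))
    (fun d => by positivity) ?_).trans ?_
  · intro d hd χ hχ
    have hd0 : 0 < d := Nat.pos_of_mem_divisors hd
    have hd0' : (0 : ℝ) < d := by exact_mod_cast hd0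
    have : NeZero (q / d) := ⟨(Nat.div_pos (Nat.divisor_le hd) hd0).ne'⟩
    have hsum := hmain (q / d) χ hχ ⌊y⌋₊ (x / d) (γ * x) (by positivity)
    have hterm : ∀ m : ℕ, Complex.exp (2 * Real.pi * Complex.I * ((γ * x : ℝ) : ℂ) *
          ((m / (x / d) : ℝ) : ℂ)) * (Φ (m / (x / d)) : ℂ) =
        Complex.exp (2 * Real.pi * Complex.I * ((d * m : ℕ) * γ)) * (Φ ((d * m : ℕ) / x) : ℂ) := by
      intro m
      have h1 : (m / (x / d) : ℝ) = (d * m : ℕ) / x := by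
        push_cast
        field_simp
      have hxc : (x : ℂ) ≠ 0 := by exact_mod_cast hx0.ne'
      rw [h1]
      congr 2
      push_cast
      field_simp
    simp_rw [hterm] at hsum
    refine hsum.trans ?_
    have : ((q / d : ℕ) : ℝ) ≤ q := by exact_mod_cast Nat.div_le_self q d
    gcongr
  · have hbound : ∀ d ∈ q.divisors, Real.sqrt ((q / d : ℕ) : ℝ) *
        (C * (x / d) ^ (1 / 2 + η) * (q : ℝ) ^ η * L ^ (1 / 2 + η)) ≤
        C * x ^ (1 / 2 + η) * (q * L) ^ (1 / 2 + η) * (d : ℝ) ^ (-(1 + η)) := by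
      intro d hd
      have hd0' : (0 : ℝ) < d := by exact_mod_cast Nat.pos_of_mem_divisors hd
      have h1 : ((q / d : ℕ) : ℝ) = q / d := Nat.cast_div (Nat.dvd_of_mem_divisors hd) hd0'.ne'
      rw [h1, Real.sqrt_eq_rpow, Real.div_rpow hq0.le hd0'.le, Real.div_rpow hx0.le hd0'.le,
        Real.mul_rpow hq0.le hL0.le, show -(1 + η) = -(1 / 2) - (1 / 2 + η) by ring,
        Real.rpow_sub hd0', Real.rpow_neg hd0'.le, Real.rpow_add hq0]
      apply le_of_eq
      field_simp
    refine (Finset.sum_le_sum hbound).trans ?_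
    rw [← Finset.mul_sum]
    have hZd : ∑ d ∈ q.divisors, (d : ℝ) ^ (-(1 + η)) ≤ Z + 1 :=
      (hZs.sum_le_tsum _ fun _ _ => by positivity).trans (by linarith)
    have hpow : (q * L) ^ (1 / 2 + η) ≤ 2 ^ (1 / 2 + η) * x ^ (1 / 4 + η / 2) := by
      calc (q * L) ^ (1 / 2 + η) ≤ (2 * Real.sqrt x) ^ (1 / 2 + η) := by gcongr
        _ = _ := by
          rw [Real.mul_rpow (by norm_num) (Real.sqrt_nonneg x), Real.sqrt_eq_rpow,
            ← Real.rpow_mul hx0.le]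
          ring_nf
    calc _ ≤ C * x ^ (1 / 2 + η) * (2 ^ (1 / 2 + η) * x ^ (1 / 4 + η / 2)) * (Z + 1) := by gcongr
      _ = C * 2 ^ (1 / 2 + η) * (Z + 1) * (x ^ (1 / 2 + η) * x ^ (1 / 4 + η / 2)) := by ring
      _ ≤ C * 2 ^ (1 / 2 + η) * (Z + 1) * x ^ ((3 : ℝ) / 4 + ε) := by
        rw [← Real.rpow_add hx0]
        exact mul_le_mul_of_nonneg_left
          (Real.rpow_le_rpow_of_exponent_le hx (by linarith)) (by positivity)
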